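/- arXiv:1911.06619 — 4 statements merged into one kernel-verified Lean document; each statement's English description precedes it below -/
import Mathlib

section
/- Let X be a Peano space (a connected, locally connected, compact metric space) containing more than one point which is homeomorphic neither to [0,1] nor to S¹. Then X has a junction point: there exist a point x ∈ X and three Jordan arcs A₁, A₂, A₃ ⊆ X which all contain x but are otherwise pairwise disjoint (their pairwise intersections equal {x}). -/
open Set Metric

/-- A Jordan arc in a topological space: a homeomorphic copy of `[0,1]`. -/
def IsJordanArc {X : Type*} [TopologicalSpace X] (A : Set X) : Prop :=
  Nonempty (↥(Set.Icc (0:ℝ) 1) ≃ₜ ↥A)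

open Filter Topology

section PathConstruction

variable {X : Type*} [MetricSpace X]

/-- Two points lie in a common connected open set all of whose points are within `ε`. -/
def ConnectedWithin (ε : ℝ) (x y : X) : Prop :=
  ∃ C : Set X, IsOpen C ∧ IsPreconnected C ∧ x ∈ C ∧ y ∈ C ∧ ∀ u ∈ C, ∀ v ∈ C, dist u v ≤ ε

lemma ConnectedWithin.dist_le {ε : ℝ} {x y : X} (h : ConnectedWithin ε x y) : dist x y ≤ ε := by
  obtain ⟨C, -, -, hx, hy, hC⟩ := h
  exact hC x hx y hy

lemma ConnectedWithin.symm {ε : ℝ} {x y : X} (h : ConnectedWithin ε x y) :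
    ConnectedWithin ε y x := by
  obtain ⟨C, ho, hc, hx, hy, hC⟩ := h
  exact ⟨C, ho, hc, hy, hx, hC⟩

lemma eventually_connectedWithin [LocallyConnectedSpace X] {ε : ℝ} (hε : 0 < ε) (x : X) :
    ∀ᶠ y in 𝓝 x, ConnectedWithin ε x y := by
  obtain ⟨V, hV, hVo, hxV, hVc⟩ := locallyConnectedSpace_iff_subsets_isOpen_isConnected.1
    ‹LocallyConnectedSpace X› x (Metric.ball x (ε / 2)) (Metric.ball_mem_nhds x (by positivity))
  filter_upwards [hVo.mem_nhds hxV] with y hy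
  refine ⟨V, hVo, hVc.isPreconnected, hxV, hy, fun u hu v hv ↦ ?_⟩
  have h₁ := Metric.mem_ball.1 (hV hu)
  have h₂ := Metric.mem_ball.1 (hV hv)
  linarith [dist_triangle_right u v x]

lemma connectedWithin_refl [LocallyConnectedSpace X] {ε : ℝ} (hε : 0 < ε) (x : X) :
    ConnectedWithin ε x x :=
  (eventually_connectedWithin hε x).self_of_nhds

lemma ConnectedWithin.exists_chain [LocallyConnectedSpace X] {ε δ : ℝ} (hδ : 0 < δ) {x y : X}
    (h : ConnectedWithin ε x y) :
    ∃ (L : ℕ) (z : ℕ → X), z 0 = x ∧ (∀ j, L ≤ j → z j = y) ∧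
      (∀ j, ConnectedWithin δ (z j) (z (j + 1))) ∧ ∀ j, dist x (z j) ≤ ε := by
  obtain ⟨C, ho, hc, hx, hy, hC⟩ := h
  suffices H : ∃ (L : ℕ) (z : ℕ → X), z 0 = x ∧ (∀ j, L ≤ j → z j = y) ∧
      (∀ j, ConnectedWithin δ (z j) (z (j + 1))) ∧ ∀ j, z j ∈ C by
    obtain ⟨L, z, h₀, h₁, h₂, h₃⟩ := H
    exact ⟨L, z, h₀, h₁, h₂, fun j ↦ hC x hx _ (h₃ j)⟩
  refine hc.induction₂ (fun x y ↦ ∃ (L : ℕ) (z : ℕ → X), z 0 = x ∧ (∀ j, L ≤ j → z j = y) ∧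
      (∀ j, ConnectedWithin δ (z j) (z (j + 1))) ∧ ∀ j, z j ∈ C) ?_ ?_ ?_ hx hy
  · intro u hu
    filter_upwards [mem_nhdsWithin_of_mem_nhds (eventually_connectedWithin hδ u),
      self_mem_nhdsWithin] with v hv hvC
    refine ⟨1, fun j ↦ if j = 0 then u else v, by simp, fun j hj ↦ by simp; omega, ?_, ?_⟩
    · rintro (_ | j)
      · simpa using hv
      · simpa using connectedWithin_refl hδ v
    · intro j
      dsimp only
      split_ifs <;> assumption
  · rintro u v w - - - ⟨L, z, h₀, h₁, h₂, h₃⟩ ⟨L', z', h₀', h₁', h₂', h₃'⟩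
    refine ⟨L + L', fun j ↦ if j < L then z j else z' (j - L), ?_, ?_, ?_, ?_⟩
    · dsimp only
      split_ifs with hL
      · exact h₀
      · rw [Nat.zero_sub, h₀', ← h₀, h₁ 0 (by omega)]
    · intro j hj
      dsimp only
      rw [if_neg (by omega), h₁' _ (by omega)]
    · intro j
      dsimp only
      rcases lt_trichotomy (j + 1) L with hj | hj | hj
      · rw [if_pos hj, if_pos (by omega)]
        exact h₂ j
      · rw [if_pos (by omega), if_neg (by omega), hj, Nat.sub_self, h₀', ← h₁ L le_rfl, ← hj]
        exact h₂ j
      · rw [if_neg (by omega), if_neg (by omega), Nat.sub_add_comm (by omega)]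
        exact h₂' _
    · intro j
      dsimp only
      split_ifs
      · exact h₃ _
      · exact h₃' _
  · rintro u v - - ⟨L, z, h₀, h₁, h₂, h₃⟩
    refine ⟨L, fun j ↦ z (L - j), by simp [h₁], fun j hj ↦ by simp [Nat.sub_eq_zero_of_le hj, h₀],
      fun j ↦ ?_, fun j ↦ h₃ _⟩
    rcases lt_or_ge j L with hj | hj
    · have := h₂ (L - (j + 1))
      rw [show L - (j + 1) + 1 = L - j by omega] at this
      exact this.symm
    · dsimp only
      rw [show L - j = 0 by omega, show L - (j + 1) = 0 by omega]
      exact connectedWithin_refl hδ _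

/-- A sequence from `x` to `y`, constant from index `M` on, whose consecutive terms are
`ConnectedWithin ε`. -/
def IsChainFrom (x y : X) (ε : ℝ) (M : ℕ) (w : ℕ → X) : Prop :=
  w 0 = x ∧ (∀ k, M ≤ k → w k = y) ∧ ∀ k, ConnectedWithin ε (w k) (w (k + 1))

lemma IsChainFrom.exists_refinement [LocallyConnectedSpace X] {x y : X} {ε δ : ℝ} {M : ℕ}
    {w : ℕ → X} (hw : IsChainFrom x y ε M w) (hε : 0 < ε) (hδ : 0 < δ) :
    ∃ (N : ℕ) (w' : ℕ → X), 0 < N ∧ IsChainFrom x y δ (N * M) w' ∧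
      ∀ k, dist (w (k / N)) (w' k) ≤ ε := by
  obtain ⟨h₀, h₁, h₂⟩ := hw
  choose L z z₀ z₁ z₂ z₃ using fun i ↦ (h₂ i).exists_chain hδ
  set K := (Finset.range M).sup L
  have key : ∀ i, ∃ ζ : ℕ → X, ζ 0 = w i ∧ (∀ j, K ≤ j → ζ j = w (i + 1)) ∧
      (∀ j, ConnectedWithin δ (ζ j) (ζ (j + 1))) ∧ (∀ j, dist (w i) (ζ j) ≤ ε) ∧
      (M ≤ i → ∀ j, ζ j = y) := by
    intro i
    rcases lt_or_ge i M with hi | hi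
    · have : L i ≤ K := Finset.le_sup (Finset.mem_range.2 hi)
      exact ⟨z i, z₀ i, fun j hj ↦ z₁ i j (this.trans hj), z₂ i, z₃ i, fun h ↦ by omega⟩
    · refine ⟨fun _ ↦ y, (h₁ i hi).symm, fun j _ ↦ (h₁ _ (by omega)).symm,
        fun j ↦ connectedWithin_refl hδ y, fun j ↦ ?_, fun _ _ ↦ rfl⟩
      rw [h₁ i hi, dist_self]
      exact hε.le
  choose ζ ζ₀ ζ₁ ζ₂ ζ₃ ζ₄ using key
  refine ⟨K + 1, fun k ↦ ζ (k / (K + 1)) (k % (K + 1)), by omega, ⟨?_, ?_, ?_⟩, fun k ↦ ζ₃ _ _⟩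
  · simp [ζ₀, h₀]
  · intro k hk
    exact ζ₄ _ ((Nat.le_div_iff_mul_le (by omega)).2 (by rwa [mul_comm])) _
  · intro k
    dsimp only
    have hlt := Nat.mod_lt k (Nat.succ_pos K)
    have hdm := Nat.div_add_mod k (K + 1)
    set q := k / (K + 1)
    set r := k % (K + 1)
    rcases Nat.lt_or_ge r K with hr | hr
    · have h : (k + 1) / (K + 1) = q ∧ (k + 1) % (K + 1) = r + 1 := by
        rw [Nat.div_mod_unique (by omega)]
        omega
      rw [h.1, h.2]
      exact ζ₂ _ _
    · have h : (k + 1) / (K + 1) = q + 1 ∧ (k + 1) % (K + 1) = 0 := by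
        rw [Nat.div_mod_unique (by omega)]
        constructor
        · rw [mul_add, mul_one]
          omega
        · omega
      rw [h.1, h.2, ζ₀, ζ₁ _ _ hr]
      exact connectedWithin_refl hδ _

lemma ConnectedWithin.exists_continuous [CompleteSpace X] [LocallyConnectedSpace X] {C : ℝ}
    (hC : 0 < C) {x y : X} (h : ConnectedWithin (C / 2) x y) :
    ∃ f : ℝ → X, Continuous f ∧ f 0 = x ∧ f 1 = y ∧ ∀ t, dist x (f t) ≤ 2 * C := by
  have hpos (n : ℕ) : 0 < C / 2 / 2 ^ n := by positivity
  let S (n : ℕ) := {p : ℕ × (ℕ → X) // IsChainFrom x y (C / 2 / 2 ^ n) p.1 p.2}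
  have step (n : ℕ) (p : S n) : ∃ (N : ℕ) (p' : S (n + 1)), 0 < N ∧ p'.1.1 = N * p.1.1 ∧
      ∀ k, dist (p.1.2 (k / N)) (p'.1.2 k) ≤ C / 2 / 2 ^ n := by
    obtain ⟨N, w', hN, hw', hd⟩ := p.2.exists_refinement (hpos n) (hpos (n + 1))
    exact ⟨N, ⟨(N * p.1.1, w'), hw'⟩, hN, rfl, hd⟩
  choose N next hN hM hdist using step
  let base : S 0 := ⟨(1, fun k ↦ if k = 0 then x else y), by simp, fun k hk ↦ by simp; omega, by
    rintro (_ | k)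
    · simpa using h
    · simpa using connectedWithin_refl (by positivity) y⟩
  let s (n : ℕ) : S n := Nat.rec base (fun n p ↦ next n p) n
  let g (n : ℕ) (t : ℝ) : X := (s n).1.2 ⌊((s n).1.1 : ℝ) * t⌋₊
  have hg (t : ℝ) (n : ℕ) : dist (g n t) (g (n + 1) t) ≤ C / 2 / 2 ^ n := by
    have h₁ := hdist n (s n) ⌊((s (n + 1)).1.1 : ℝ) * t⌋₊
    have h₂ : ⌊((s (n + 1)).1.1 : ℝ) * t⌋₊ / N n (s n) = ⌊((s n).1.1 : ℝ) * t⌋₊ := by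
      rw [← Nat.floor_div_natCast]
      congr 1
      have : (s (n + 1)).1.1 = N n (s n) * (s n).1.1 := hM n (s n)
      have h₀ : (N n (s n) : ℝ) ≠ 0 := by exact_mod_cast (hN n (s n)).ne'
      rw [this]
      push_cast
      field_simp
    rwa [h₂] at h₁
  choose f hf using fun t ↦ cauchySeq_tendsto_of_complete (cauchySeq_of_le_geometric_two (hg t))
  have hgf (t : ℝ) (n : ℕ) : dist (g n t) (f t) ≤ C / 2 ^ n :=
    dist_le_of_le_geometric_two_of_tendsto (hg t) (hf t) n
  have hMn (n : ℕ) : (s n).1.1 ≥ 1 := by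
    induction n with
    | zero => exact le_rfl
    | succ n ih =>
      have : (s (n + 1)).1.1 = N n (s n) * (s n).1.1 := hM n (s n)
      rw [this]
      exact Nat.mul_pos (hN _ _) ih
  refine ⟨f, ?_, ?_, ?_, ?_⟩
  · rw [Metric.continuous_iff']
    intro t ε hε
    obtain ⟨n, hn⟩ := exists_pow_lt_of_lt_one (show 0 < ε / (3 * C) by positivity)
      (show (1 / 2 : ℝ) < 1 by norm_num)
    have hn' : 3 * (C / 2 ^ n) < ε := by
      rw [lt_div_iff₀ (by positivity), one_div, inv_pow] at hn
      rw [div_eq_mul_inv]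
      linarith
    have hm : (0 : ℝ) < (s n).1.1 := by exact_mod_cast hMn n
    have hnear : ∀ᶠ u in 𝓝 t, |((s n).1.1 : ℝ) * u - (s n).1.1 * t| < 1 := by
      have : Tendsto (fun u ↦ |((s n).1.1 : ℝ) * u - (s n).1.1 * t|) (𝓝 t) (𝓝 0) := by
        have : Continuous (fun u ↦ |((s n).1.1 : ℝ) * u - (s n).1.1 * t|) := by fun_prop
        simpa using this.tendsto t
      exact this.eventually_lt_const one_pos
    filter_upwards [hnear] with u hu
    have hjump : dist (g n u) (g n t) ≤ C / 2 / 2 ^ n := by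
      rw [abs_lt] at hu
      have hle (a b : ℝ) (hab : a < b + 1) : ⌊a⌋₊ ≤ ⌊b⌋₊ + 1 := by
        rcases le_total b 0 with hb | hb
        · rw [Nat.floor_of_nonpos hb]
          refine Nat.floor_le_of_le ?_
          push_cast
          linarith
        · rw [← Nat.floor_add_one hb]
          exact Nat.floor_le_floor hab.le
      have h₁ := hle _ _ (show ((s n).1.1 : ℝ) * u < (s n).1.1 * t + 1 by linarith)
      have h₂ := hle _ _ (show ((s n).1.1 : ℝ) * t < (s n).1.1 * u + 1 by linarith)
      obtain h | h | h : ⌊((s n).1.1 : ℝ) * u⌋₊ = ⌊((s n).1.1 : ℝ) * t⌋₊ ∨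
          ⌊((s n).1.1 : ℝ) * u⌋₊ = ⌊((s n).1.1 : ℝ) * t⌋₊ + 1 ∨
          ⌊((s n).1.1 : ℝ) * t⌋₊ = ⌊((s n).1.1 : ℝ) * u⌋₊ + 1 := by omega
      · simp only [g, h, dist_self]
        exact (hpos n).le
      · simp only [g, h]
        exact ((s n).2.2.2 _).symm.dist_le
      · simp only [g, h]
        exact ((s n).2.2.2 _).dist_le
    have e₁ := hgf u n
    have e₂ := hgf t n
    rw [dist_comm] at e₁
    have e₃ : C / 2 / 2 ^ n ≤ C / 2 ^ n := by gcongr; linarith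
    linarith [dist_triangle4 (f u) (g n u) (g n t) (f t)]
  · refine tendsto_nhds_unique (hf 0) ?_
    have : ∀ n, g n 0 = x := fun n ↦ by simp [g, (s n).2.1]
    simp [this]
  · refine tendsto_nhds_unique (hf 1) ?_
    have : ∀ n, g n 1 = y := fun n ↦ by simp [g, (s n).2.2.1]
    simp [this]
  · intro t
    have h₁ := hgf t 0
    have h₂ : dist x (g 0 t) ≤ C / 2 := by
      change dist x (if ⌊((1 : ℕ) : ℝ) * t⌋₊ = 0 then x else y) ≤ C / 2
      split_ifs
      · rw [dist_self]
        positivity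
      · exact h.dist_le
    rw [pow_zero, div_one] at h₁
    linarith [dist_triangle x (g 0 t) (f t)]

theorem locallyPathConnectedSpace_of_locallyConnectedSpace [CompleteSpace X]
    [LocallyConnectedSpace X] : LocallyPathConnectedSpace X := by
  rw [locallyPathConnectedSpace_iff_pathComponentIn_mem_nhds]
  intro x U hU hx
  obtain ⟨r, hr, hrU⟩ := Metric.isOpen_iff.1 hU x hx
  filter_upwards [eventually_connectedWithin (show 0 < r / 3 / 2 by positivity) x] with y hy
  obtain ⟨f, hf, h₀, h₁, hd⟩ := hy.exists_continuous (by positivity)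
  refine JoinedIn.ofLine hf.continuousOn h₀ h₁ ?_
  rintro _ ⟨t, -, rfl⟩
  refine hrU ?_
  rw [Metric.mem_ball, dist_comm]
  linarith [hd t]

end PathConstruction

section Arcs

variable {X : Type*}

/-- `A` is a Jordan arc with endpoints `a` and `b`. -/
def ArcBetween [TopologicalSpace X] (a b : X) (A : Set X) : Prop :=
  ∃ f : ℝ → X, ContinuousOn f (Icc 0 1) ∧ InjOn f (Icc 0 1) ∧ f 0 = a ∧ f 1 = b ∧
    f '' Icc 0 1 = A

lemma ArcBetween.of_Icc [TopologicalSpace X] {c d : ℝ} (hcd : c < d) {f : ℝ → X}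
    (hf : ContinuousOn f (Icc c d)) (hi : InjOn f (Icc c d)) :
    ArcBetween (f c) (f d) (f '' Icc c d) := by
  have himg : (fun t ↦ (d - c) * t + c) '' Icc (0 : ℝ) 1 = Icc c d := by
    rw [image_affine_Icc' (by linarith)]
    simp
  have hmaps : MapsTo (fun t ↦ (d - c) * t + c) (Icc (0 : ℝ) 1) (Icc c d) :=
    mapsTo_iff_image_subset.2 himg.subset
  refine ⟨f ∘ fun t ↦ (d - c) * t + c, hf.comp (by fun_prop) hmaps, hi.comp ?_ hmaps, by simp,
    by simp, by rw [image_comp, himg]⟩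
  intro s _ t _ h
  have : d - c ≠ 0 := by linarith
  simpa [this] using h

lemma exists_gap {F : Set ℝ} (hF : IsClosed F) {a b m : ℝ} (ha : a ∈ F) (hb : b ∈ F) (hm : m ∉ F)
    (ham : a ≤ m) (hmb : m ≤ b) :
    ∃ s ∈ F, ∃ t ∈ F, a ≤ s ∧ s < m ∧ m < t ∧ t ≤ b ∧ Disjoint (Ioo s t) F := by
  obtain ⟨s, hs, hs'⟩ := (isCompact_Icc.inter_left hF : IsCompact (F ∩ Icc a m)).exists_isGreatest
    ⟨a, ha, left_mem_Icc.2 ham⟩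
  obtain ⟨t, ht, ht'⟩ := (isCompact_Icc.inter_left hF : IsCompact (F ∩ Icc m b)).exists_isLeast
    ⟨b, hb, right_mem_Icc.2 hmb⟩
  have hsm : s < m := hs.2.2.lt_of_ne fun h ↦ hm (h ▸ hs.1)
  have hmt : m < t := ht.2.1.lt_of_ne fun h ↦ hm (h ▸ ht.1)
  refine ⟨s, hs.1, t, ht.1, hs.2.1, hsm, hmt, ht.2.2, Set.disjoint_left.2 fun u hu huF ↦ ?_⟩
  rcases le_total u m with h | h
  · exact (hs' ⟨huF, hs.2.1.trans hu.1.le, h⟩).not_gt hu.1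
  · exact (ht' ⟨huF, h, hu.2.le.trans ht.2.2⟩).not_gt hu.2

/-- A closed subset of `[0,1]` containing `0` and `1` such that `f` takes the same value at both
ends of each complementary interval. -/
def GapClosed (f : ℝ → X) (F : Set ℝ) : Prop :=
  IsClosed F ∧ F ⊆ Icc 0 1 ∧ 0 ∈ F ∧ 1 ∈ F ∧
    ∀ s ∈ F, ∀ t ∈ F, s < t → Disjoint (Ioo s t) F → f s = f t

lemma gapClosed_Icc (f : ℝ → X) : GapClosed f (Icc 0 1) := by
  refine ⟨isClosed_Icc, Subset.rfl, by simp, by simp, fun s hs t ht hst h ↦ ?_⟩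
  exact absurd ⟨by linarith [hs.1], by linarith [ht.2]⟩
    (Set.disjoint_left.1 h (show (s + t) / 2 ∈ Ioo s t from ⟨by linarith, by linarith⟩))

lemma mem_image_inter_Iic (f : ℝ → X) {F : Set ℝ} {u x : ℝ} (hu : u ∈ F) (hux : u ≤ x) :
    f u ∈ f '' (F ∩ Iic x) :=
  mem_image_of_mem f ⟨hu, hux⟩

variable [MetricSpace X]

lemma GapClosed.sInter {f : ℝ → X} (hf : Continuous f) {c : Set (Set ℝ)}
    (hc : ∀ F ∈ c, GapClosed f F) (hchain : IsChain (· ⊆ ·) c) (hne : c.Nonempty) :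
    GapClosed f (⋂₀ c) := by
  have hclosed : IsClosed (⋂₀ c) := isClosed_sInter fun F hF ↦ (hc F hF).1
  obtain ⟨F₀, hF₀⟩ := hne
  refine ⟨hclosed, (sInter_subset_of_mem hF₀).trans (hc F₀ hF₀).2.1, fun F hF ↦ (hc F hF).2.2.1,
    fun F hF ↦ (hc F hF).2.2.2.1, fun s hs t ht hst hdisj ↦ ?_⟩
  by_contra hne
  have hd : 0 < dist (f s) (f t) / 2 := by
    have := dist_pos.2 hne
    positivity
  obtain ⟨ε₁, hε₁, h₁⟩ := Metric.continuous_iff.1 hf s _ hd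
  obtain ⟨ε₂, hε₂, h₂⟩ := Metric.continuous_iff.1 hf t _ hd
  obtain ⟨ε, hε, hε₁', hε₂', hst'⟩ : ∃ ε > 0, ε < ε₁ ∧ ε < ε₂ ∧ ε < (t - s) / 2 :=
    ⟨min (min ε₁ ε₂) ((t - s) / 2) / 2, by have := sub_pos.2 hst; positivity, by
      have : 0 < (t - s) / 2 := by linarith
      have h : 0 < min (min ε₁ ε₂) ((t - s) / 2) := by positivity
      have := min_le_left (min ε₁ ε₂) ((t - s) / 2)
      have := min_le_right (min ε₁ ε₂) ((t - s) / 2)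
      have := min_le_left ε₁ ε₂
      have := min_le_right ε₁ ε₂
      exact ⟨by linarith, by linarith, by linarith⟩⟩
  have : Nonempty c := ⟨⟨F₀, hF₀⟩⟩
  obtain ⟨⟨G, hG⟩, hGe⟩ :=
    (isCompact_Icc : IsCompact (Icc (s + ε) (t - ε))).elim_directed_family_closed (fun F : c ↦ (F : Set ℝ)) (fun F ↦ (hc F F.2).1) (by
      rw [← sInter_eq_iInter, ← disjoint_iff_inter_eq_empty]
      exact hdisj.mono_left
        (Icc_subset_Ioo (by linarith) (by linarith) : Icc (s + ε) (t - ε) ⊆ Ioo s t))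
    (by
      rintro ⟨A, hA⟩ ⟨B, hB⟩
      rcases hchain.total hA hB with h | h
      · exact ⟨⟨A, hA⟩, Subset.rfl, h⟩
      · exact ⟨⟨B, hB⟩, h, Subset.rfl⟩)
  have hnot : ∀ u, s + ε ≤ u → u ≤ t - ε → u ∉ G := fun u h h' hu ↦
    (hGe.subset ⟨⟨h, h'⟩, hu⟩ : u ∈ (∅ : Set ℝ))
  obtain ⟨s', hs', t', ht', h₃, h₄, h₅, h₆, h₇⟩ := exists_gap (hc G hG).1 (hs G hG) (ht G hG)
    (hnot ((s + t) / 2) (by linarith) (by linarith)) (by linarith) (by linarith)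
  have hs'' : s' < s + ε := by
    by_contra! h
    exact hnot s' h (by linarith) hs'
  have ht'' : t - ε < t' := by
    by_contra! h
    exact hnot t' (by linarith) h ht'
  have e := (hc G hG).2.2.2.2 s' hs' t' ht' (h₄.trans h₅) h₇
  have e₁ := h₁ s' (by rw [Real.dist_eq, abs_lt]; constructor <;> linarith)
  have e₂ := h₂ t' (by rw [Real.dist_eq, abs_lt]; constructor <;> linarith)
  rw [e] at e₁
  linarith [dist_triangle_left (f s) (f t) (f t')]

lemma exists_minimal_gapClosed {f : ℝ → X} (hf : Continuous f) :
    ∃ F, GapClosed f F ∧ ∀ s ∈ F, ∀ t ∈ F, s < t → f s = f t → Disjoint (Ioo s t) F := by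
  obtain ⟨F, -, hF⟩ := zorn_superset_nonempty {F | GapClosed f F}
    (fun c hc hchain hne ↦ ⟨⋂₀ c, GapClosed.sInter hf hc hchain hne,
      fun F hF ↦ sInter_subset_of_mem hF⟩) _ (gapClosed_Icc f)
  obtain ⟨hcl, hsub, h0, h1, hgap⟩ := hF.prop
  refine ⟨F, hF.prop, fun s hs t ht hst hfst ↦ ?_⟩
  have hF' : GapClosed f (F \ Ioo s t) := by
    refine ⟨hcl.sdiff isOpen_Ioo, sdiff_subset.trans hsub, ⟨h0, fun h ↦ ?_⟩, ⟨h1, fun h ↦ ?_⟩, ?_⟩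
    · exact h.1.not_ge (hsub hs).1
    · exact h.2.not_ge (hsub ht).2
    rintro u ⟨hu, hu'⟩ v ⟨hv, hv'⟩ huv hdisj
    by_cases h : Disjoint (Ioo u v) F
    · exact hgap u hu v hv huv h
    obtain ⟨p, hp, hpF⟩ := Set.not_disjoint_iff.1 h
    have hpst : p ∈ Ioo s t := by
      by_contra hp'
      exact Set.disjoint_left.1 hdisj hp ⟨hpF, hp'⟩
    have hs' : s ∉ Ioo u v := fun h ↦ Set.disjoint_left.1 hdisj h ⟨hs, by simp⟩
    have ht' : t ∉ Ioo u v := fun h ↦ Set.disjoint_left.1 hdisj h ⟨ht, by simp⟩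
    simp only [mem_Ioo, not_and_or, not_lt] at *
    have hus : u = s := by grind
    have hvt : v = t := by grind
    rw [hus, hvt, hfst]
  exact Set.disjoint_left.2 fun u hu huF ↦ (hF.le_of_le hF' sdiff_subset huF).2 hu

/-- The distance from `q` to the part of the image of `F` traced up to `x`. -/
noncomputable def tracedDist (f : ℝ → X) (F : Set ℝ) (q : X) (x : ℝ) : ℝ :=
  infDist q (f '' (F ∩ Iic x))

lemma tracedDist_le (f : ℝ → X) {F : Set ℝ} (q : X) {u x : ℝ} (hu : u ∈ F) (hux : u ≤ x) :
    tracedDist f F q x ≤ dist q (f u) :=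
  infDist_le_dist_of_mem (mem_image_inter_Iic f hu hux)

lemma tracedDist_antitoneOn (f : ℝ → X) (F : Set ℝ) (q : X) : AntitoneOn (tracedDist f F q) F :=
  fun x hx _ _ hxy ↦ infDist_le_infDist_of_subset
    (image_mono (inter_subset_inter_right _ (Iic_subset_Iic.2 hxy)))
    ⟨f x, mem_image_inter_Iic f hx le_rfl⟩

lemma continuousOn_tracedDist {f : ℝ → X} (hf : Continuous f) {F : Set ℝ} (hF : IsCompact F)
    (q : X) : ContinuousOn (tracedDist f F q) F := by
  rw [Metric.continuousOn_iff]
  intro x hx ε hε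
  obtain ⟨δ, hδ, h⟩ := Metric.uniformContinuousOn_iff.1
    (hF.uniformContinuousOn_of_continuous hf.continuousOn) (ε / 2) (by positivity)
  have key : ∀ u ∈ F, ∀ v ∈ F, u ≤ v → v - u < δ →
      tracedDist f F q u - ε / 2 ≤ tracedDist f F q v := by
    intro u hu v hv huv hd
    refine (le_infDist ⟨f v, mem_image_inter_Iic f hv le_rfl⟩).2 ?_
    rintro _ ⟨w, ⟨hw, hwv⟩, rfl⟩
    have hwv : w ≤ v := hwv
    rcases le_total w u with hwu | hwu
    · have : tracedDist f F q u ≤ dist q (f w) := tracedDist_le f q hw hwu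
      linarith
    · have h₁ : tracedDist f F q u ≤ dist q (f u) := tracedDist_le f q hu le_rfl
      have h₂ := h w hw u hu (by rw [Real.dist_eq, abs_lt]; constructor <;> linarith)
      linarith [dist_triangle q (f w) (f u)]
  refine ⟨δ, hδ, fun y hy hyx ↦ ?_⟩
  rw [Real.dist_eq, abs_lt] at *
  rcases le_total x y with hxy | hxy
  · have h₁ := key x hx y hy hxy (by linarith)
    have h₂ := tracedDist_antitoneOn f F q hx hy hxy
    constructor <;> linarith
  · have h₁ := key y hy x hx hxy (by linarith)
    have h₂ := tracedDist_antitoneOn f F q hy hx hxy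
    constructor <;> linarith

lemma exists_monotone_parameter [CompactSpace X] {f : ℝ → X} (hf : Continuous f) {F : Set ℝ}
    (hF : IsCompact F) (hgap : ∀ s ∈ F, ∀ t ∈ F, s < t → Disjoint (Ioo s t) F → f s = f t)
    (hmin : ∀ s ∈ F, ∀ t ∈ F, s < t → f s = f t → Disjoint (Ioo s t) F) :
    ∃ φ : ℝ → ℝ, ContinuousOn φ F ∧ MonotoneOn φ F ∧
      ∀ s ∈ F, ∀ t ∈ F, φ s = φ t ↔ f s = f t := by
  rcases F.eq_empty_or_nonempty with rfl | ⟨x₀, hx₀⟩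
  · exact ⟨id, by simp, by simp [MonotoneOn], by simp⟩
  have : Nonempty X := ⟨f x₀⟩
  set q := TopologicalSpace.denseSeq X
  set D := Metric.diam (univ : Set X)
  have hbound : ∀ n, ∀ x ∈ F, ‖(1 / 2 : ℝ) ^ n * tracedDist f F (q n) x‖ ≤ (1 / 2) ^ n * D := by
    intro n x hx
    have h₀ : 0 ≤ tracedDist f F (q n) x := infDist_nonneg
    rw [Real.norm_of_nonneg (by positivity)]
    gcongr
    exact (tracedDist_le f _ hx le_rfl).trans
      (dist_le_diam_of_mem isCompact_univ.isBounded (mem_univ _) (mem_univ _))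
  have hsumD : Summable fun n : ℕ ↦ (1 / 2 : ℝ) ^ n * D := summable_geometric_two.mul_right D
  have hsum : ∀ x ∈ F, Summable fun n ↦ (1 / 2 : ℝ) ^ n * tracedDist f F (q n) x := fun x hx ↦
    Summable.of_norm_bounded hsumD fun n ↦ hbound n x hx
  set ψ : ℝ → ℝ := fun x ↦ ∑' n, (1 / 2 : ℝ) ^ n * tracedDist f F (q n) x
  have hle : ∀ s ∈ F, ∀ t ∈ F, s ≤ t → ∀ n, (1 / 2 : ℝ) ^ n * tracedDist f F (q n) t ≤
      (1 / 2 : ℝ) ^ n * tracedDist f F (q n) s := by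
    intro s hs t ht hst n
    gcongr
    exact tracedDist_antitoneOn f F (q n) hs ht hst
  have hkey : ∀ s ∈ F, ∀ t ∈ F, s < t → (ψ s = ψ t ↔ f s = f t) := by
    intro s hs t ht hst
    constructor
    · intro h
      by_contra hne
      have hnot : f t ∉ f '' (F ∩ Iic s) := by
        rintro ⟨u, ⟨hu, hus⟩, hut⟩
        rcases (show u ≤ s from hus).eq_or_lt with rfl | hus
        · exact hne hut
        · exact Set.disjoint_left.1 (hmin u hu t ht (hus.trans hst) hut) ⟨hus, hst⟩ hs
      have hcl : IsClosed (f '' (F ∩ Iic s)) := ((hF.inter_right isClosed_Iic).image hf).isClosed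
      have hne' : (f '' (F ∩ Iic s)).Nonempty := ⟨f s, mem_image_inter_Iic f hs le_rfl⟩
      have hpos : 0 < infDist (f t) (f '' (F ∩ Iic s)) :=
        (hcl.notMem_iff_infDist_pos hne').1 hnot
      obtain ⟨n, hn⟩ := (TopologicalSpace.denseRange_denseSeq X).exists_dist_lt (f t)
        (show 0 < infDist (f t) (f '' (F ∩ Iic s)) / 2 by positivity)
      have h₁ : tracedDist f F (q n) t ≤ dist (f t) (q n) := by
        rw [dist_comm]
        exact tracedDist_le f _ ht le_rfl
      have h₂ : infDist (f t) (f '' (F ∩ Iic s)) ≤ tracedDist f F (q n) s + dist (f t) (q n) :=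
        infDist_le_infDist_add_dist
      refine (Summable.tsum_lt_tsum (i := n) (hle s hs t ht hst.le) ?_ (hsum t ht) (hsum s hs)).ne'
        h
      gcongr
      change dist (f t) (q n) < _ at hn
      linarith
    · intro h
      have hd := hmin s hs t ht hst h
      have : f '' (F ∩ Iic s) = f '' (F ∩ Iic t) := by
        refine (image_mono (inter_subset_inter_right _ (Iic_subset_Iic.2 hst.le))).antisymm ?_
        rintro _ ⟨u, ⟨hu, hut⟩, rfl⟩
        rcases (show u ≤ t from hut).eq_or_lt with rfl | hut
        · exact h ▸ mem_image_inter_Iic f hs le_rfl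
        · refine ⟨u, ⟨hu, ?_⟩, rfl⟩
          by_contra! hsu
          exact Set.disjoint_left.1 hd ⟨not_le.1 hsu, hut⟩ hu
      simp only [ψ, tracedDist, this]
  refine ⟨fun x ↦ -ψ x, ?_, ?_, ?_⟩
  · exact (continuousOn_tsum (fun n ↦ (continuousOn_tracedDist hf hF (q n)).const_mul _) hsumD
      fun n x hx ↦ hbound n x hx).neg
  · intro s hs t ht hst
    exact neg_le_neg ((hsum t ht).tsum_le_tsum (hle s hs t ht hst) (hsum s hs))
  · intro s hs t ht
    rw [neg_inj]
    rcases lt_trichotomy s t with h | rfl | h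
    · exact hkey s hs t ht h
    · simp
    · rw [eq_comm, hkey t ht s hs h, eq_comm]

theorem exists_arcBetween_of_continuous [CompactSpace X] {f : ℝ → X} (hf : Continuous f)
    (hne : f 0 ≠ f 1) : ∃ A ⊆ f '' Icc 0 1, ArcBetween (f 0) (f 1) A := by
  obtain ⟨F, ⟨hcl, hsub, h0, h1, hgap⟩, hmin⟩ := exists_minimal_gapClosed hf
  have hF : IsCompact F := isCompact_Icc.of_isClosed_subset hcl hsub
  obtain ⟨φ, hφ, hmono, hiff⟩ := exists_monotone_parameter hf hF hgap hmin
  have hlt : φ 0 < φ 1 := (hmono h0 h1 zero_le_one).lt_of_ne fun h ↦ hne ((hiff 0 h0 1 h1).1 h)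
  have himg : φ '' F = Icc (φ 0) (φ 1) := by
    have hsub' : φ '' F ⊆ Icc (φ 0) (φ 1) := by
      rintro _ ⟨x, hx, rfl⟩
      exact ⟨hmono h0 hx (hsub hx).1, hmono hx h1 (hsub hx).2⟩
    refine hsub'.antisymm fun v hv ↦ ?_
    by_contra hv'
    have hc₁ : IsCompact (F ∩ φ ⁻¹' Iic v) :=
      hF.of_isClosed_subset (hφ.preimage_isClosed_of_isClosed hcl isClosed_Iic) inter_subset_left
    have hc₂ : IsCompact (F ∩ φ ⁻¹' Ici v) :=
      hF.of_isClosed_subset (hφ.preimage_isClosed_of_isClosed hcl isClosed_Ici) inter_subset_left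
    obtain ⟨s, ⟨hs, hsv⟩, hs'⟩ := hc₁.exists_isGreatest ⟨0, h0, hv.1⟩
    obtain ⟨t, ⟨ht, htv⟩, ht'⟩ := hc₂.exists_isLeast ⟨1, h1, hv.2⟩
    have hsv : φ s < v := (show φ s ≤ v from hsv).lt_of_ne fun h ↦ hv' ⟨s, hs, h⟩
    have htv : v < φ t := (show v ≤ φ t from htv).lt_of_ne fun h ↦ hv' ⟨t, ht, h.symm⟩
    have hst : s < t := by
      by_contra! h
      exact (hmono ht hs h).not_gt (hsv.trans htv)
    refine (hsv.trans htv).ne ((hiff s hs t ht).2 (hgap s hs t ht hst ?_))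
    refine Set.disjoint_left.2 fun u hu huF ↦ ?_
    rcases le_total (φ u) v with h | h
    · exact (hs' ⟨huF, h⟩).not_gt hu.1
    · exact (ht' ⟨huF, h⟩).not_gt hu.2
  choose! σ hσF hσ using fun v (hv : v ∈ Icc (φ 0) (φ 1)) ↦ himg.symm.subset hv
  have hσφ : ∀ x ∈ F, f (σ (φ x)) = f x := fun x hx ↦ by
    have hx' := himg.subset (mem_image_of_mem φ hx)
    exact (hiff _ (hσF _ hx') _ hx).1 (hσ _ hx')
  have hcont : ContinuousOn (f ∘ σ) (Icc (φ 0) (φ 1)) := by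
    rw [continuousOn_iff_isClosed]
    intro D hD
    refine ⟨φ '' (F ∩ f ⁻¹' D), ?_, ?_⟩
    · exact ((hF.inter_right (hD.preimage hf)).image_of_continuousOn
        (hφ.mono inter_subset_left)).isClosed
    · ext v
      constructor
      · rintro ⟨hvD, hv⟩
        exact ⟨⟨σ v, ⟨hσF v hv, hvD⟩, hσ v hv⟩, hv⟩
      · rintro ⟨⟨x, ⟨hx, hxD⟩, rfl⟩, hv⟩
        refine ⟨?_, hv⟩
        rw [mem_preimage, Function.comp_apply, hσφ x hx]
        exact hxD
  have hinj : InjOn (f ∘ σ) (Icc (φ 0) (φ 1)) := by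
    intro u hu v hv h
    have := (hiff _ (hσF u hu) _ (hσF v hv)).2 h
    rwa [hσ u hu, hσ v hv] at this
  refine ⟨(f ∘ σ) '' Icc (φ 0) (φ 1), ?_, ?_⟩
  · rw [image_comp]
    exact image_mono (image_subset_iff.2 fun v hv ↦ hsub (hσF v hv))
  · have := ArcBetween.of_Icc hlt hcont hinj
    rwa [Function.comp_apply, Function.comp_apply, hσφ 0 h0, hσφ 1 h1] at this

theorem IsOpen.exists_arcBetween [CompactSpace X] [LocallyConnectedSpace X] {U : Set X}
    (hU : IsOpen U) (hc : IsPreconnected U) {a b : X} (ha : a ∈ U) (hb : b ∈ U) (hab : a ≠ b) :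
    ∃ A ⊆ U, ArcBetween a b A := by
  have := locallyPathConnectedSpace_of_locallyConnectedSpace (X := X)
  have hJ := (hU.isConnected_iff_isPathConnected.1 ⟨⟨a, ha⟩, hc⟩).joinedIn a ha b hb
  set γ := hJ.somePath
  obtain ⟨A, hA, hA'⟩ := exists_arcBetween_of_continuous (f := γ.extend) γ.continuous_extend
    (by simpa using hab)
  refine ⟨A, hA.trans ?_, by simpa using hA'⟩
  rintro _ ⟨t, ht, rfl⟩
  rw [γ.extend_apply ht]
  exact hJ.somePath_mem _

end Arcs

namespace ArcBetween

variable {X : Type*} [TopologicalSpace X] {a b c p q r : X} {A B C : Set X}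

lemma left_mem (h : ArcBetween a b A) : a ∈ A := by
  obtain ⟨f, -, -, rfl, -, rfl⟩ := h
  exact mem_image_of_mem f (by simp)

lemma right_mem (h : ArcBetween a b A) : b ∈ A := by
  obtain ⟨f, -, -, -, rfl, rfl⟩ := h
  exact mem_image_of_mem f (by simp)

lemma isCompact (h : ArcBetween a b A) : IsCompact A := by
  obtain ⟨f, hf, -, -, -, rfl⟩ := h
  exact isCompact_Icc.image_of_continuousOn hf

lemma isJordanArc [T2Space X] (h : ArcBetween a b A) : IsJordanArc A := by
  obtain ⟨f, hf, hi, -, -, rfl⟩ := h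
  exact ⟨Continuous.homeoOfEquivCompactToT2 (f := Equiv.ofBijective _ hi.bijOn_image.bijective)
    (hf.mapsToRestrict (mapsTo_image f _))⟩

lemma symm (h : ArcBetween a b A) : ArcBetween b a A := by
  obtain ⟨f, hf, hi, rfl, rfl, rfl⟩ := h
  have himg : (fun t : ℝ ↦ 1 - t) '' Icc 0 1 = Icc 0 1 := by simp
  have hmaps : MapsTo (fun t : ℝ ↦ 1 - t) (Icc 0 1) (Icc 0 1) :=
    mapsTo_iff_image_subset.2 himg.subset
  exact ⟨f ∘ fun t ↦ 1 - t, hf.comp (by fun_prop) hmaps,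
    hi.comp (fun s _ t _ h ↦ by simpa using h) hmaps, by simp, by simp, by rw [image_comp, himg]⟩

lemma trans (hA : ArcBetween a b A) (hB : ArcBetween b c B) (hAB : A ∩ B = {b}) :
    ArcBetween a c (A ∪ B) := by
  obtain ⟨f, hf, hfi, rfl, rfl, rfl⟩ := hA
  obtain ⟨g, hg, hgi, hg0, rfl, rfl⟩ := hB
  set k : ℝ → X := fun t ↦ if t ≤ 1 then f t else g (t - 1)
  have hk₁ : EqOn k f (Icc 0 1) := fun t ht ↦ if_pos ht.2
  have hk₂ : EqOn k (fun t ↦ g (t - 1)) (Icc 1 2) := fun t ht ↦ by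
    rcases ht.1.eq_or_lt with rfl | h
    · simp [k, hg0]
    · exact if_neg h.not_ge
  have himg : (fun t : ℝ ↦ t - 1) '' Icc 1 2 = Icc 0 1 := by simp; norm_num
  have hmaps : MapsTo (fun t : ℝ ↦ t - 1) (Icc 1 2) (Icc 0 1) :=
    mapsTo_iff_image_subset.2 himg.subset
  have hU : Icc (0 : ℝ) 1 ∪ Icc 1 2 = Icc 0 2 := Icc_union_Icc_eq_Icc (by simp) (by simp)
  have hcross : ∀ s ∈ Icc (0 : ℝ) 1, ∀ t ∈ Icc (1 : ℝ) 2, k s = k t → s = t := by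
    intro s hs t ht h
    rw [hk₁ hs, hk₂ ht] at h
    have h₁ : f s = f 1 := hAB.subset
      ⟨mem_image_of_mem f hs, h ▸ mem_image_of_mem g (hmaps ht)⟩
    have hs1 : s = 1 := hfi hs (by simp) h₁
    have ht1 : t - 1 = 0 := hgi (hmaps ht) (by simp) (by rw [hg0, ← h₁, h])
    linarith
  have key := of_Icc (c := 0) (d := 2) (f := k) two_pos ?_ ?_
  · rw [← hU, image_union, hk₁.image_eq, hk₂.image_eq, ← Function.comp_def g, image_comp, himg,
      hk₁ (by simp), hk₂ (by simp)] at key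
    norm_num at key
    exact key
  · rw [← hU]
    exact (hf.congr hk₁).union_of_isClosed ((hg.comp (by fun_prop) hmaps).congr hk₂)
      isClosed_Icc isClosed_Icc
  · rw [← hU]
    rintro s (hs | hs) t (ht | ht) h
    · exact hfi hs ht (by rwa [hk₁ hs, hk₁ ht] at h)
    · exact hcross s hs t ht h
    · exact (hcross t ht s hs h.symm).symm
    · rw [hk₂ hs, hk₂ ht] at h
      linarith [hgi (hmaps hs) (hmaps ht) h]

lemma exists_split (h : ArcBetween a b A) (hc : c ∈ A) (hca : c ≠ a) (hcb : c ≠ b) :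
    ∃ A₁ A₂, ArcBetween a c A₁ ∧ ArcBetween c b A₂ ∧ A₁ ∪ A₂ = A ∧ A₁ ∩ A₂ = {c} := by
  obtain ⟨f, hf, hi, rfl, rfl, rfl⟩ := h
  obtain ⟨s, hs, rfl⟩ := hc
  have h₀ : 0 < s := hs.1.lt_of_ne (by rintro rfl; exact hca rfl)
  have h₁ : s < 1 := hs.2.lt_of_ne (by rintro rfl; exact hcb rfl)
  have hU : Icc 0 s ∪ Icc s 1 = Icc 0 1 := Icc_union_Icc_eq_Icc hs.1 hs.2
  have hs₁ : Icc 0 s ⊆ Icc 0 1 := Icc_subset_Icc_right hs.2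
  have hs₂ : Icc s 1 ⊆ Icc 0 1 := Icc_subset_Icc_left hs.1
  refine ⟨_, _, of_Icc h₀ (hf.mono hs₁) (hi.mono hs₁), of_Icc h₁ (hf.mono hs₂) (hi.mono hs₂),
    by rw [← image_union, hU], ?_⟩
  rw [← hi.image_inter hs₁ hs₂, Icc_inter_Icc_eq_singleton hs.1 hs.2, image_singleton]

lemma exists_first_hit (h : ArcBetween a b A) {K : Set X} (hK : IsClosed K) (ha : a ∉ K)
    (hb : b ∈ K) : ∃ z ∈ K, ∃ B ⊆ A, ArcBetween a z B ∧ B ∩ K = {z} := by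
  obtain ⟨f, hf, hi, rfl, rfl, rfl⟩ := h
  obtain ⟨s, ⟨hs, hsK⟩, hmin⟩ := (isCompact_Icc.of_isClosed_subset
    (hf.preimage_isClosed_of_isClosed isClosed_Icc hK) inter_subset_left).exists_isLeast
    ⟨1, by simp, hb⟩
  have h₀ : 0 < s := hs.1.lt_of_ne (by rintro rfl; exact ha hsK)
  have hs₁ : Icc 0 s ⊆ Icc 0 1 := Icc_subset_Icc_right hs.2
  refine ⟨f s, hsK, _, image_mono hs₁, of_Icc h₀ (hf.mono hs₁) (hi.mono hs₁), ?_⟩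
  ext x
  constructor
  · rintro ⟨⟨t, ht, rfl⟩, htK⟩
    rw [ht.2.antisymm (hmin ⟨hs₁ ht, htK⟩)]
    rfl
  · rintro rfl
    exact ⟨mem_image_of_mem f ⟨h₀.le, le_rfl⟩, hsK⟩

theorem homeomorph_sphere [T2Space X] (hA : ArcBetween a b A) (hB : ArcBetween a b B)
    (hAB : A ∩ B = {a, b}) (hU : A ∪ B = univ) :
    Nonempty (X ≃ₜ ↥(Metric.sphere (0 : ℝ × ℝ) 1)) := by
  obtain ⟨f, hf, hfi, rfl, rfl, rfl⟩ := hA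
  obtain ⟨g, hg, hgi, hg0, hg1, rfl⟩ := hB
  let S := Metric.sphere (0 : ℝ × ℝ) 1
  have hS (p : S) : max |p.1.1| |p.1.2| = 1 := mem_sphere_zero_iff_norm.1 p.2
  have hpos (p : S) : 0 < |p.1.1| + |p.1.2| := by
    have := hS p
    rcases max_choice |p.1.1| |p.1.2| with h | h
    · linarith [abs_nonneg p.1.2]
    · linarith [abs_nonneg p.1.1]
  let u (p : S) : ℝ := (1 + p.1.1 / (|p.1.1| + |p.1.2|)) / 2
  have hu : Continuous u :=
    (continuous_const.add (Continuous.div (by fun_prop) (by fun_prop)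
      fun p ↦ (hpos p).ne')).div_const 2
  have hmem (p : S) : u p ∈ Icc 0 1 := by
    have h₁ := hpos p
    have h : |p.1.1 / (|p.1.1| + |p.1.2|)| ≤ 1 := by
      rw [abs_div, abs_of_pos h₁, div_le_one h₁]
      linarith [abs_nonneg p.1.2]
    rw [abs_le] at h
    constructor <;> simp only [u] <;> linarith
  have hend (p : S) : p.1.2 = 0 ↔ u p = 0 ∨ u p = 1 := by
    have h₁ := hpos p
    have e₀ : u p = 0 ↔ p.1.1 = -(|p.1.1| + |p.1.2|) := by
      rw [← neg_one_mul, ← div_eq_iff h₁.ne']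
      simp only [u]
      constructor <;> intro h <;> linarith
    have e₁ : u p = 1 ↔ p.1.1 = |p.1.1| + |p.1.2| := by
      rw [← div_eq_one_iff_eq h₁.ne']
      simp only [u]
      constructor <;> intro h <;> linarith
    rw [e₀, e₁, ← abs_eq_zero]
    have := abs_nonneg p.1.2
    rcases abs_cases p.1.1 with ⟨h, hn⟩ | ⟨h, hn⟩ <;> rw [h] <;> constructor
    · intro h'; right; linarith
    · rintro (h' | h') <;> linarith
    · intro h'; left; linarith
    · rintro (h' | h') <;> linarith
  have huinj (p p' : S) (h : u p = u p') (hy : 0 ≤ p.1.2 ∧ 0 ≤ p'.1.2 ∨ p.1.2 < 0 ∧ p'.1.2 < 0) :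
      p = p' := by
    have h₁ := hpos p
    have h₂ := hpos p'
    have hx : p.1.1 * (|p'.1.1| + |p'.1.2|) = p'.1.1 * (|p.1.1| + |p.1.2|) := by
      rw [← div_eq_div_iff h₁.ne' h₂.ne']
      simp only [u] at h
      linarith
    have hx' : |p.1.1| * (|p'.1.1| + |p'.1.2|) = |p'.1.1| * (|p.1.1| + |p.1.2|) := by
      have := congrArg abs hx
      rwa [abs_mul, abs_mul, abs_of_pos h₁, abs_of_pos h₂] at this
    have hy' : |p.1.2| * (|p'.1.1| + |p'.1.2|) = |p'.1.2| * (|p.1.1| + |p.1.2|) := by linarith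
    have hs : |p'.1.1| + |p'.1.2| = |p.1.1| + |p.1.2| := by
      have e := max_mul_of_nonneg |p.1.1| |p.1.2| h₂.le
      rw [hx', hy', ← max_mul_of_nonneg _ _ h₁.le, hS p, hS p', one_mul, one_mul] at e
      exact e
    rw [hs] at hx hy'
    have ex := mul_right_cancel₀ h₁.ne' hx
    have ey := mul_right_cancel₀ h₁.ne' hy'
    refine Subtype.ext (Prod.ext ex ?_)
    rcases hy with ⟨h₃, h₄⟩ | ⟨h₃, h₄⟩
    · rwa [abs_of_nonneg h₃, abs_of_nonneg h₄] at ey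
    · rw [abs_of_neg h₃, abs_of_neg h₄] at ey
      linarith
  have husurj (t : ℝ) (ht : t ∈ Icc (0 : ℝ) 1) :
      (∃ p : S, 0 ≤ p.1.2 ∧ u p = t) ∧ ∃ p : S, p.1.2 ≤ 0 ∧ u p = t := by
    have hw : |2 * t - 1| ≤ 1 := abs_le.2 ⟨by linarith [ht.1], by linarith [ht.2]⟩
    suffices H : ∀ v : ℝ, |v| = 1 - |2 * t - 1| → ∃ m > 0, ∃ p : S, p.1.2 = v / m ∧ u p = t by
      constructor
      · obtain ⟨m, hm, p, hp, hpt⟩ := H (1 - |2 * t - 1|) (abs_of_nonneg (by linarith))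
        exact ⟨p, hp ▸ div_nonneg (by linarith) hm.le, hpt⟩
      · obtain ⟨m, hm, p, hp, hpt⟩ := H (-(1 - |2 * t - 1|))
          (by rw [abs_neg, abs_of_nonneg (by linarith)])
        exact ⟨p, hp ▸ div_nonpos_of_nonpos_of_nonneg (by linarith) hm.le, hpt⟩
    intro v hv
    have hm : 0 < max |2 * t - 1| |v| := by
      by_contra! h
      linarith [le_max_left |2 * t - 1| |v|, le_max_right |2 * t - 1| |v|]
    refine ⟨_, hm, ⟨((2 * t - 1) / max |2 * t - 1| |v|, v / max |2 * t - 1| |v|), ?_⟩, rfl, ?_⟩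
    · rw [mem_sphere_zero_iff_norm, Prod.norm_def, Real.norm_eq_abs, Real.norm_eq_abs, abs_div,
        abs_div, abs_of_pos hm, max_div_div_right hm.le, div_self hm.ne']
    · simp only [u, abs_div, abs_of_pos hm, ← add_div]
      rw [div_div_div_cancel_right₀ hm.ne', hv]
      ring
  let F (p : S) : X := if 0 ≤ p.1.2 then f (u p) else g (u p)
  have hfg (p : S) (h : p.1.2 = 0) : f (u p) = g (u p) := by
    rcases (hend p).1 h with h | h <;> simp [h, hg0, hg1]
  have hF : Continuous F := by
    refine Continuous.if_le (hf.comp_continuous hu hmem) (hg.comp_continuous hu hmem)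
      continuous_const (by fun_prop) fun p hp ↦ hfg p hp.symm
  have hcross (p p' : S) (hp' : p'.1.2 < 0) : f (u p) ≠ g (u p') := by
    intro h
    have : g (u p') ∈ ({f 0, f 1} : Set X) :=
      hAB.subset ⟨h ▸ mem_image_of_mem f (hmem p), mem_image_of_mem g (hmem p')⟩
    refine hp'.ne ((hend p').2 ?_)
    rcases this with h | h
    · exact Or.inl (hgi (hmem p') (by simp) (by rw [h, hg0]))
    · exact Or.inr (hgi (hmem p') (by simp) (by rw [show g (u p') = f 1 from h, hg1]))
  have hinj : Function.Injective F := by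
    intro p p' h
    by_cases hp : 0 ≤ p.1.2 <;> by_cases hp' : 0 ≤ p'.1.2 <;> simp only [F, hp, hp', if_true, if_false]
        at h
    · exact huinj p p' (hfi (hmem p) (hmem p') h) (Or.inl ⟨hp, hp'⟩)
    · exact absurd h (hcross p p' (not_le.1 hp'))
    · exact absurd h.symm (hcross p' p (not_le.1 hp))
    · exact huinj p p' (hgi (hmem p) (hmem p') h) (Or.inr ⟨not_le.1 hp, not_le.1 hp'⟩)
  have hsurj : Function.Surjective F := by
    intro x
    rcases hU.symm.subset (mem_univ x) with ⟨t, ht, rfl⟩ | ⟨t, ht, rfl⟩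
    · obtain ⟨p, hp, rfl⟩ := (husurj t ht).1
      exact ⟨p, if_pos hp⟩
    · obtain ⟨p, hp, rfl⟩ := (husurj t ht).2
      rcases hp.eq_or_lt with h | h
      · exact ⟨p, (if_pos h.ge).trans (hfg p h)⟩
      · exact ⟨p, if_neg h.not_ge⟩
  have : CompactSpace S := isCompact_iff_compactSpace.1 (isCompact_sphere _ _)
  exact ⟨(Continuous.homeoOfEquivCompactToT2 (f := Equiv.ofBijective F ⟨hinj, hsurj⟩) hF).symm⟩

end ArcBetween

section Junction

variable {X : Type*}

/-- Three Jordan arcs share one point and are otherwise pairwise disjoint. -/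
def HasJunction (X : Type*) [TopologicalSpace X] : Prop :=
  ∃ (x : X) (A₁ A₂ A₃ : Set X),
    IsJordanArc A₁ ∧ IsJordanArc A₂ ∧ IsJordanArc A₃ ∧
    x ∈ A₁ ∧ x ∈ A₂ ∧ x ∈ A₃ ∧
    A₁ ∩ A₂ = {x} ∧ A₁ ∩ A₃ = {x} ∧ A₂ ∩ A₃ = {x}

lemma inter_eq_singleton_of_subset {A A' B B' : Set X} {x : X} (h : A ∩ B = {x}) (hA : A' ⊆ A)
    (hB : B' ⊆ B) (hxA : x ∈ A') (hxB : x ∈ B') : A' ∩ B' = {x} :=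
  ((inter_subset_inter hA hB).trans h.subset).antisymm (singleton_subset_iff.2 ⟨hxA, hxB⟩)

lemma ArcBetween.eq_endpoint_of_inter_eq [TopologicalSpace X] [T2Space X] (h : ¬ HasJunction X)
    {a b z q : X} {A B : Set X} (hA : ArcBetween a b A) (hB : ArcBetween z q B)
    (hAB : A ∩ B = {z}) : z = a ∨ z = b := by
  by_contra! hne
  have hz : z ∈ A := (hAB.symm.subset rfl).1
  obtain ⟨A₁, A₂, h₁, h₂, rfl, hi⟩ := hA.exists_split hz hne.1 hne.2
  exact h ⟨z, A₁, A₂, B, h₁.isJordanArc, h₂.isJordanArc, hB.isJordanArc, h₁.right_mem, h₂.left_mem,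
    hB.left_mem, hi,
    inter_eq_singleton_of_subset hAB subset_union_left Subset.rfl h₁.right_mem hB.left_mem,
    inter_eq_singleton_of_subset hAB subset_union_right Subset.rfl h₂.left_mem hB.left_mem⟩

variable [MetricSpace X] [CompactSpace X] [LocallyConnectedSpace X]

lemma IsClosed.exists_arc_of_notMem_nhds {A U : Set X} (hA : IsClosed A) {x : X} (hx : x ∈ A)
    (hAx : A ∉ 𝓝 x) (hU : U ∈ 𝓝 x) :
    ∃ q z B, z ∈ U ∧ ArcBetween z q B ∧ A ∩ B = {z} := by
  obtain ⟨V, hVU, hVo, hxV, hVc⟩ := locallyConnectedSpace_iff_subsets_isOpen_isConnected.1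
    ‹LocallyConnectedSpace X› x U hU
  obtain ⟨q, hqV, hqA⟩ := not_subset.1 fun h ↦ hAx (mem_of_superset (hVo.mem_nhds hxV) h)
  obtain ⟨B, hBV, hB⟩ := hVo.exists_arcBetween hVc.isPreconnected hqV hxV
    (by rintro rfl; exact hqA hx)
  obtain ⟨z, -, B', hB', hqz, hi⟩ := hB.exists_first_hit hA hqA hx
  exact ⟨q, z, B', hVU (hBV (hB' hqz.right_mem)), hqz.symm, by rwa [inter_comm]⟩

lemma ArcBetween.mem_nhds (h : ¬ HasJunction X) {a b x : X} {A : Set X} (hA : ArcBetween a b A)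
    (hx : x ∈ A) (hxa : x ≠ a) (hxb : x ≠ b) : A ∈ 𝓝 x := by
  by_contra hAx
  obtain ⟨q, z, B, hz, hB, hi⟩ := hA.isCompact.isClosed.exists_arc_of_notMem_nhds hx hAx
    (inter_mem (isOpen_ne.mem_nhds hxa) (isOpen_ne.mem_nhds hxb))
  rcases hA.eq_endpoint_of_inter_eq h hB hi with rfl | rfl
  · exact hz.1 rfl
  · exact hz.2 rfl

lemma ArcBetween.isClopen_triangle (h : ¬ HasJunction X) {p q r : X} {A B C : Set X}
    (hA : ArcBetween r p A) (hB : ArcBetween r q B) (hC : ArcBetween p q C) (hAB : A ∩ B = {r})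
    (hAC : A ∩ C = {p}) (hBC : B ∩ C = {q}) (hpq : p ≠ q) (hrp : r ≠ p) (hrq : r ≠ q) :
    IsClopen (A ∪ B ∪ C) := by
  refine ⟨((hA.isCompact.union hB.isCompact).union hC.isCompact).isClosed,
    isOpen_iff_mem_nhds.2 fun x hx ↦ ?_⟩
  have h₁ : ArcBetween p q (A ∪ B) := hA.symm.trans hB hAB
  have h₂ : ArcBetween r q (A ∪ C) := hA.trans hC hAC
  have h₃ : ArcBetween r p (B ∪ C) := hB.trans hC.symm hBC
  have s₁ : A ∪ B ⊆ A ∪ B ∪ C := subset_union_left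
  have s₂ : A ∪ C ⊆ A ∪ B ∪ C := union_subset_union_left _ subset_union_left
  have s₃ : B ∪ C ⊆ A ∪ B ∪ C := union_subset_union_left _ subset_union_right
  by_cases hxp : x = p
  · subst hxp
    exact mem_of_superset (h₂.mem_nhds h (Or.inl hA.right_mem) hrp.symm hpq) s₂
  by_cases hxq : x = q
  · subst hxq
    exact mem_of_superset (h₃.mem_nhds h (Or.inl hB.right_mem) hrq.symm hpq.symm) s₃
  by_cases hxr : x = r
  · subst hxr
    exact mem_of_superset (h₁.mem_nhds h (Or.inl hA.left_mem) hrp hrq) s₁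
  rcases hx with hx | hx
  · exact mem_of_superset (h₁.mem_nhds h hx hxp hxq) s₁
  · exact mem_of_superset (h₂.mem_nhds h (Or.inr hx) hxr hxq) s₂

lemma ArcBetween.subset_of_endpoints_mem [ConnectedSpace X] (h : ¬ HasJunction X)
    (hcircle : ¬ Nonempty (X ≃ₜ ↥(Metric.sphere (0 : ℝ × ℝ) 1))) {a b c d : X} {A B : Set X}
    (hA : ArcBetween a b A) (hB : ArcBetween c d B) (hc : c ∈ A) (hd : d ∈ A) : B ⊆ A := by
  intro r hr
  by_contra hrA
  have hcl := hA.isCompact.isClosed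
  obtain ⟨B₁, B₂, h₁, h₂, rfl, hi⟩ := hB.exists_split hr (by rintro rfl; exact hrA hc)
    (by rintro rfl; exact hrA hd)
  obtain ⟨p, hp, P, hPB, hP, hPA⟩ := h₁.symm.exists_first_hit hcl hrA hc
  obtain ⟨q, hq, Q, hQB, hQ, hQA⟩ := h₂.exists_first_hit hcl hrA hd
  have hPQ : P ∩ Q = {r} := inter_eq_singleton_of_subset hi hPB hQB hP.left_mem hQ.left_mem
  have hpq : p ≠ q := by
    rintro rfl
    have : p = r := hPQ.subset ⟨hP.right_mem, hQ.right_mem⟩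
    exact hrA (this ▸ hp)
  have hC : ArcBetween p q A := by
    have ep := hA.eq_endpoint_of_inter_eq h hP.symm (by rwa [inter_comm])
    have eq := hA.eq_endpoint_of_inter_eq h hQ.symm (by rwa [inter_comm])
    rcases ep with rfl | rfl <;> rcases eq with rfl | rfl
    · exact absurd rfl hpq
    · exact hA
    · exact hA.symm
    · exact absurd rfl hpq
  have hclopen := hP.isClopen_triangle h hQ hC hPQ hPA hQA hpq (by rintro rfl; exact hrA hp)
    (by rintro rfl; exact hrA hq)
  refine hcircle ((hP.symm.trans hQ hPQ).homeomorph_sphere hC ?_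
    (hclopen.eq_univ ⟨p, Or.inr hC.left_mem⟩))
  rw [union_inter_distrib_right, hPA, hQA]
  rfl

variable [ConnectedSpace X]

lemma ArcBetween.exists_superset_mem (h : ¬ HasJunction X) {a b : X} {A : Set X}
    (hA : ArcBetween a b A) (q : X) : ∃ a' b' A', ArcBetween a' b' A' ∧ A ⊆ A' ∧ q ∈ A' := by
  by_cases hq : q ∈ A
  · exact ⟨a, b, A, hA, Subset.rfl, hq⟩
  obtain ⟨B, -, hB⟩ := isOpen_univ.exists_arcBetween isPreconnected_univ (mem_univ q) (mem_univ a)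
    (by rintro rfl; exact hq hA.left_mem)
  obtain ⟨z, -, B', -, hB', hi⟩ := hB.exists_first_hit hA.isCompact.isClosed hq hA.left_mem
  rcases hA.eq_endpoint_of_inter_eq h hB'.symm (by rwa [inter_comm]) with rfl | rfl
  · exact ⟨_, _, _, hB'.trans hA hi, subset_union_right, Or.inl hB'.left_mem⟩
  · exact ⟨_, _, _, hB'.trans hA.symm hi, subset_union_right, Or.inl hB'.left_mem⟩

variable [Nontrivial X]

lemma exists_arcBetween_mem_nhds (h : ¬ HasJunction X) (x : X) :
    ∃ a b A, ArcBetween a b A ∧ A ∈ 𝓝 x := by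
  obtain ⟨y, hyx⟩ := exists_ne x
  obtain ⟨A, -, hA⟩ := isOpen_univ.exists_arcBetween isPreconnected_univ (mem_univ x) (mem_univ y)
    hyx.symm
  by_cases hAx : A ∈ 𝓝 x
  · exact ⟨x, y, A, hA, hAx⟩
  obtain ⟨q, z, B, hz, hB, hi⟩ := hA.isCompact.isClosed.exists_arc_of_notMem_nhds hA.left_mem hAx
    (isOpen_ne.mem_nhds hyx.symm)
  obtain rfl : z = x := (hA.eq_endpoint_of_inter_eq h hB hi).resolve_right hz
  have hC : ArcBetween q y (B ∪ A) := hB.symm.trans hA (by rwa [inter_comm])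
  refine ⟨q, y, B ∪ A, hC, hC.mem_nhds h (Or.inl hB.left_mem) ?_ hyx.symm⟩
  rintro rfl
  obtain ⟨f, -, hf, h0, h1, -⟩ := hB
  exact zero_ne_one (hf (by simp) (by simp) (h0.trans h1.symm))

lemma exists_arcBetween_superset_finset (h : ¬ HasJunction X) (S : Finset X) :
    ∃ a b A, ArcBetween a b A ∧ (S : Set X) ⊆ A := by
  classical
  induction S using Finset.induction_on with
  | empty =>
    obtain ⟨x⟩ := (inferInstance : Nonempty X)
    obtain ⟨a, b, A, hA, -⟩ := exists_arcBetween_mem_nhds h x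
    exact ⟨a, b, A, hA, by simp⟩
  | insert q S _ ih =>
    obtain ⟨a, b, A, hA, hS⟩ := ih
    obtain ⟨a', b', A', hA', hAA', hq⟩ := hA.exists_superset_mem h q
    refine ⟨a', b', A', hA', ?_⟩
    rw [Finset.coe_insert]
    exact insert_subset hq (hS.trans hAA')

theorem exists_arcBetween_univ (h : ¬ HasJunction X)
    (hcircle : ¬ Nonempty (X ≃ₜ ↥(Metric.sphere (0 : ℝ × ℝ) 1))) :
    ∃ a b : X, ArcBetween a b univ := by
  classical
  choose a b A hA hAx using exists_arcBetween_mem_nhds (X := X) h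
  obtain ⟨t, ht⟩ := CompactSpace.elim_nhds_subcover A hAx
  obtain ⟨c, d, B, hB, hS⟩ := exists_arcBetween_superset_finset h (t.image a ∪ t.image b)
  refine ⟨c, d, ?_⟩
  rwa [univ_subset_iff.1 (ht.symm.subset.trans (iUnion₂_subset fun x hx ↦
    hB.subset_of_endpoints_mem h hcircle (hA x) (hS ?_) (hS ?_)))] at hB
  · exact Finset.mem_union_left _ (Finset.mem_image_of_mem a hx)
  · exact Finset.mem_union_right _ (Finset.mem_image_of_mem b hx)

end Junction

/-- a Peano space (connected, locally connected, compact metric space)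
with more than one point which is homeomorphic neither to `[0,1]` nor to `S¹` has a
junction point: three Jordan arcs meeting at a single point and otherwise disjoint. -/
theorem peano_space_has_junction_point {X : Type*} [MetricSpace X]
    [CompactSpace X] [ConnectedSpace X] [LocallyConnectedSpace X] [Nontrivial X]
    (hnotarc : ¬ Nonempty (X ≃ₜ ↥(Set.Icc (0:ℝ) 1)))
    (hnotcircle : ¬ Nonempty (X ≃ₜ ↥(Metric.sphere (0 : ℝ × ℝ) 1))) :
    ∃ (x : X) (A₁ A₂ A₃ : Set X),
      IsJordanArc A₁ ∧ IsJordanArc A₂ ∧ IsJordanArc A₃ ∧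
      x ∈ A₁ ∧ x ∈ A₂ ∧ x ∈ A₃ ∧
      A₁ ∩ A₂ = {x} ∧ A₁ ∩ A₃ = {x} ∧ A₂ ∩ A₃ = {x} := by
  by_contra h
  obtain ⟨a, b, hab⟩ := exists_arcBetween_univ (X := X) h hnotcircle
  obtain ⟨e⟩ := hab.isJordanArc
  exact hnotarc ⟨(Homeomorph.Set.univ X).symm.trans e.symm⟩
end

section
/- Let Ω ⊆ ℝ² be open, u : Ω → ℝ continuous and monotone, t ∈ ℝ, and let E be a connected component of the level set u⁻¹(t). Then either E exits all compact subsets of Ω, or ℝ² \ E has at least one bounded component and every bounded component of ℝ² \ E intersects ∂Ω. In particular, diam(E) ≥ sup_{x ∈ E} dist(x, ∂Ω) > 0. -/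
open Set Metric EMetric

/-- Lebesgue monotonicity on an open set. -/
def LebMonotoneOn {E : Type*} [TopologicalSpace E] (Ω : Set E) (f : E → ℝ) : Prop :=
  ∀ U : Set E, IsOpen U → U.Nonempty → IsCompact (closure U) → closure U ⊆ Ω →
    (∃ x ∈ frontier U, ∀ y ∈ closure U, f y ≤ f x) ∧
    (∃ x ∈ frontier U, ∀ y ∈ closure U, f x ≤ f y)

open Topology

/-- Components of a closed set are closed. -/
theorem IsClosed.isClosed_connectedComponentIn {X : Type*} [TopologicalSpace X] {F : Set X}
    (hF : IsClosed F) (x : X) : IsClosed (connectedComponentIn F x) := by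
  by_cases hx : x ∈ F
  · refine isClosed_of_closure_subset ?_
    exact isPreconnected_connectedComponentIn.closure.subset_connectedComponentIn
      (subset_closure (mem_connectedComponentIn hx))
      (closure_minimal (connectedComponentIn_subset F x) hF)
  · rw [connectedComponentIn_eq_empty hx]
    exact isClosed_empty

/-- In a locally connected space, the boundary of a component of `F` lies in the boundary of
`F`. -/
theorem frontier_connectedComponentIn_subset {X : Type*} [TopologicalSpace X]
    [LocallyConnectedSpace X] (F : Set X) (x : X) :
    frontier (connectedComponentIn F x) ⊆ frontier F := by
  intro z hz
  refine ⟨closure_mono (connectedComponentIn_subset F x) hz.1, fun hzi => hz.2 ?_⟩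
  have hn : connectedComponentIn F z ∈ 𝓝 z :=
    connectedComponentIn_mem_nhds (mem_interior_iff_mem_nhds.1 hzi)
  obtain ⟨w, hwz, hwx⟩ := mem_closure_iff_nhds.1 hz.1 _ hn
  rw [connectedComponentIn_eq hwx, ← connectedComponentIn_eq hwz]
  exact mem_interior_iff_mem_nhds.2 hn

/-- A compact subset of a connected open set is contained in a compact connected subset of it. -/
theorem IsCompact.exists_isCompact_isPreconnected_between {X : Type*} [TopologicalSpace X]
    [T2Space X] [LocallyCompactSpace X] [LocallyPathConnectedSpace X] {G M : Set X}
    (hM : IsCompact M) (hG : IsOpen G) (hGc : IsConnected G) (hMG : M ⊆ G) :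
    ∃ C, IsCompact C ∧ IsPreconnected C ∧ M ⊆ C ∧ C ⊆ G := by
  obtain ⟨p, hp⟩ := hGc.nonempty
  have hpath : IsPathConnected G := hG.isConnected_iff_isPathConnected.1 hGc
  suffices h : ∃ C, IsCompact C ∧ IsPreconnected C ∧ M ⊆ C ∧ C ⊆ G ∧ p ∈ C by
    obtain ⟨C, h1, h2, h3, h4, -⟩ := h
    exact ⟨C, h1, h2, h3, h4⟩
  refine hM.induction_on
    (p := fun S => ∃ C, IsCompact C ∧ IsPreconnected C ∧ S ⊆ C ∧ C ⊆ G ∧ p ∈ C)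
    ?_ ?_ ?_ ?_
  · exact ⟨{p}, isCompact_singleton, isPreconnected_singleton, empty_subset _,
      singleton_subset_iff.2 hp, rfl⟩
  · rintro s t hst ⟨C, h1, h2, h3, h4⟩
    exact ⟨C, h1, h2, hst.trans h3, h4⟩
  · rintro s t ⟨C, h1, h2, h3, h4, h5⟩ ⟨D, k1, k2, k3, k4, k5⟩
    exact ⟨C ∪ D, h1.union k1, h2.union p h5 k5 k2, union_subset_union h3 k3,
      union_subset h4 k4, Or.inl h5⟩
  · intro x hx
    obtain ⟨K, ⟨hKx, hK⟩, hKG⟩ := (compact_basis_nhds x).mem_iff.1 (hG.mem_nhds (hMG hx))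
    obtain ⟨γ, hγ⟩ := hpath.joinedIn p hp x (hMG hx)
    have hN := connectedComponentIn_mem_nhds (F := K) hKx
    have hxK : x ∈ connectedComponentIn K x := mem_of_mem_nhds hN
    refine ⟨connectedComponentIn K x, mem_nhdsWithin_of_mem_nhds hN,
      range γ ∪ connectedComponentIn K x, (isCompact_range γ.continuous).union
      (hK.of_isClosed_subset (hK.isClosed.isClosed_connectedComponentIn x)
        (connectedComponentIn_subset K x)), ?_, subset_union_right, ?_, Or.inl ⟨0, γ.source⟩⟩
    · exact (isPreconnected_range γ.continuous).union x ⟨1, γ.target⟩ hxK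
        isPreconnected_connectedComponentIn
    · exact union_subset (range_subset_iff.2 hγ) ((connectedComponentIn_subset K x).trans hKG)

/-- In a compact set `K`, a component contained in an open set `O` is separated from the rest
of `K` by a relatively clopen set contained in `O`. -/
theorem IsCompact.exists_isCompact_of_connectedComponentIn_subset {X : Type*} [TopologicalSpace X]
    [T2Space X] {K O : Set X} (hK : IsCompact K) (hO : IsOpen O) {x : X} (hx : x ∈ K)
    (h : connectedComponentIn K x ⊆ O) :
    ∃ F F', IsCompact F ∧ IsCompact F' ∧ F ∪ F' = K ∧ Disjoint F F' ∧ x ∈ F ∧ F ⊆ O := by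
  have : CompactSpace K := isCompact_iff_compactSpace.1 hK
  rw [connectedComponentIn_eq_image hx, connectedComponent_eq_iInter_isClopen] at h
  have : Nonempty {s : Set K // IsClopen s ∧ ⟨x, hx⟩ ∈ s} :=
    ⟨⟨univ, isClopen_univ, mem_univ _⟩⟩
  obtain ⟨⟨S, hS, hxS⟩, hSO⟩ := exists_subset_nhds_of_compactSpace
    (V := fun s : {s : Set K // IsClopen s ∧ ⟨x, hx⟩ ∈ s} => (s : Set K))
    (U := ((↑) : K → X) ⁻¹' O)
    (fun s t => ⟨⟨s.1 ∩ t.1, s.2.1.inter t.2.1, s.2.2, t.2.2⟩, inter_subset_left,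
      inter_subset_right⟩) (fun s => s.2.1.1)
    (fun y hy => (hO.preimage continuous_subtype_val).mem_nhds (h (mem_image_of_mem _ hy)))
  refine ⟨(↑) '' S, (↑) '' Sᶜ, hS.1.isCompact.image continuous_subtype_val,
    hS.compl.1.isCompact.image continuous_subtype_val, ?_, ?_, ⟨_, hxS, rfl⟩,
    image_subset_iff.2 hSO⟩
  · rw [← image_union, union_compl_self, image_univ, Subtype.range_coe]
  · exact (disjoint_image_iff Subtype.val_injective).2 disjoint_compl_right

/-- A form of unicoherence for simply connected spaces: if closed sets `A`, `B` cover the space,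
`B` is connected, and `A ∩ B` lies in a connected subset of `A`, then `A ∩ B` is connected. -/
theorem isPreconnected_inter_of_union_eq_univ {X : Type*} [TopologicalSpace X]
    [SimplyConnectedSpace X] [LocallyPathConnectedSpace X] [NormalSpace X] {A B T : Set X}
    (hA : IsClosed A) (hB : IsClosed B) (hAB : A ∪ B = univ) (hBc : IsPreconnected B)
    (hT : IsPreconnected T) (hTA : T ⊆ A) (hABT : A ∩ B ⊆ T) : IsPreconnected (A ∩ B) := by
  classical
  rw [isPreconnected_closed_iff]
  rintro t t' ht ht' hsub ⟨p, hps, hpt⟩ ⟨q, hqs, hqt⟩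
  by_contra hne
  have hdisj : Disjoint ((A ∩ B) ∩ t) ((A ∩ B) ∩ t') := by
    rw [Set.disjoint_left]
    exact fun z hz hz' => hne ⟨z, hz.1, hz.2, hz'.2⟩
  obtain ⟨h, h0, h1, -⟩ := exists_continuous_zero_one_of_isClosed
    ((hA.inter hB).inter ht) ((hA.inter hB).inter ht') hdisj
  have hpi : Circle.exp (Real.pi * 1) = Circle.exp (-(Real.pi * 1)) := by
    rw [Circle.exp_eq_exp]
    exact ⟨1, by push_cast; ring⟩
  have hagree : ∀ z ∈ A ∩ B, Circle.exp (Real.pi * h z) = Circle.exp (-(Real.pi * h z)) := by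
    intro z hz
    rcases hsub hz with hzt | hzt
    · simp [h0 ⟨hz, hzt⟩]
    · rw [h1 ⟨hz, hzt⟩]
      exact hpi
  have hfr : frontier A ⊆ A ∩ B := by
    intro z hz
    refine ⟨hA.frontier_subset hz, ?_⟩
    rw [frontier_eq_closure_inter_closure] at hz
    refine closure_minimal (fun w hw => ?_) hB hz.2
    exact (hAB.symm ▸ mem_univ w : w ∈ A ∪ B).resolve_left hw
  let g : C(X, Circle) :=
    ⟨A.piecewise (fun z => Circle.exp (Real.pi * h z)) (fun z => Circle.exp (-(Real.pi * h z))),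
      Continuous.piecewise (fun z hz => hagree z (hfr hz)) (by fun_prop) (by fun_prop)⟩
  have hgA : ∀ z ∈ A, g z = Circle.exp (Real.pi * h z) :=
    fun z hz => A.piecewise_eq_of_mem (fun z => Circle.exp (Real.pi * h z))
      (fun z => Circle.exp (-(Real.pi * h z))) hz
  have hgB : ∀ z ∈ B, g z = Circle.exp (-(Real.pi * h z)) := by
    intro z hz
    by_cases hzA : z ∈ A
    · rw [hgA z hzA, hagree z ⟨hzA, hz⟩]
    · exact A.piecewise_eq_of_notMem (fun z => Circle.exp (Real.pi * h z))
        (fun z => Circle.exp (-(Real.pi * h z))) hzA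
  have hhp : h p = 0 := h0 ⟨hps, hpt⟩
  have hhq : h q = 1 := h1 ⟨hqs, hqt⟩
  have hgp : Circle.exp 0 = g p := by rw [hgA p hps.1, hhp, mul_zero]
  obtain ⟨θ, ⟨hθp, hθ⟩, -⟩ := Circle.isCoveringMap_exp.existsUnique_continuousMap_lifts g p 0 hgp
  have hθ' : ∀ z, Circle.exp (θ z) = g z := fun z => congrFun hθ z
  have e1 : T.EqOn θ (fun z => Real.pi * h z) :=
    Circle.isCoveringMap_exp.eqOn_of_comp_eqOn hT θ.continuous.continuousOn
      (by fun_prop) (fun z hz => by simp only [Function.comp]; rw [hθ', hgA z (hTA hz)])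
      (hABT hps) (by rw [hθp, hhp, mul_zero])
  have e2 : B.EqOn θ (fun z => -(Real.pi * h z)) :=
    Circle.isCoveringMap_exp.eqOn_of_comp_eqOn hBc θ.continuous.continuousOn
      (by fun_prop) (fun z hz => by simp only [Function.comp]; rw [hθ', hgB z hz])
      hps.2 (by rw [hθp, hhp, mul_zero, neg_zero])
  have h3 := e1 (hABT hqs)
  have h4 := e2 hqs.2
  simp only [hhq] at h3 h4
  linarith [Real.pi_pos]

/-- The exterior of a closed ball is connected in dimension at least two. -/
theorem isConnected_compl_closedBall_of_one_lt_rank {V : Type*} [NormedAddCommGroup V]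
    [NormedSpace ℝ V] (hV : 1 < Module.rank ℝ V) {R : ℝ} (hR : 0 ≤ R) :
    IsConnected (Metric.closedBall (0 : V) R)ᶜ := by
  have himage : (fun v : V => (1 + R / ‖v‖) • v) '' {0}ᶜ = (Metric.closedBall (0 : V) R)ᶜ := by
    ext w
    simp only [mem_image, mem_compl_iff, mem_singleton_iff, Metric.mem_closedBall,
      dist_zero_right, not_le]
    constructor
    · rintro ⟨v, hv, rfl⟩
      have hv' : 0 < ‖v‖ := norm_pos_iff.2 hv
      rw [norm_smul, Real.norm_of_nonneg (by positivity), add_mul, div_mul_cancel₀ _ hv'.ne']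
      linarith
    · intro hw
      have hw' : 0 < ‖w‖ := hR.trans_lt hw
      have hk : 0 < 1 - R / ‖w‖ := by rw [sub_pos, div_lt_one hw']; exact hw
      refine ⟨(1 - R / ‖w‖) • w, smul_ne_zero hk.ne' (norm_pos_iff.1 hw'), ?_⟩
      rw [norm_smul, Real.norm_of_nonneg hk.le, smul_smul]
      have : (1 - R / ‖w‖) * ‖w‖ = ‖w‖ - R := by field_simp
      rw [this]
      have hne : ‖w‖ - R ≠ 0 := (sub_pos.2 hw).ne'
      have : (1 + R / (‖w‖ - R)) * (1 - R / ‖w‖) = 1 := by field_simp; ring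
      rw [this, one_smul]
  rw [← himage]
  refine (isConnected_compl_singleton_of_one_lt_rank hV 0).image _ ?_
  refine ContinuousOn.smul (continuousOn_const.add (continuousOn_const.div
    continuous_norm.continuousOn fun v hv => norm_ne_zero_iff.2 hv)) continuousOn_id

/-- If a bounded set has no bounded complementary component, its complement is connected. -/
theorem Bornology.IsBounded.isConnected_compl_of_forall_not_isBounded {V : Type*}
    [NormedAddCommGroup V] [NormedSpace ℝ V] (hV : 1 < Module.rank ℝ V) {E : Set V}
    (hE : Bornology.IsBounded E)
    (h : ∀ y ∈ Eᶜ, ¬ Bornology.IsBounded (connectedComponentIn Eᶜ y)) : IsConnected Eᶜ := by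
  obtain ⟨R, hR, hER⟩ : ∃ R : ℝ, 0 ≤ R ∧ E ⊆ Metric.closedBall 0 R := by
    obtain ⟨R, hER⟩ := hE.subset_closedBall 0
    exact ⟨max R 0, le_max_right _ _,
      hER.trans (Metric.closedBall_subset_closedBall (le_max_left _ _))⟩
  have hW := isConnected_compl_closedBall_of_one_lt_rank hV hR
  have hWE : (Metric.closedBall (0 : V) R)ᶜ ⊆ Eᶜ := compl_subset_compl.2 hER
  obtain ⟨c, hc⟩ := hW.nonempty
  refine ⟨⟨c, hWE hc⟩, ?_⟩
  have : Eᶜ = connectedComponentIn Eᶜ c := by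
    refine subset_antisymm (fun y hy => ?_) (connectedComponentIn_subset _ _)
    obtain ⟨w, hwy, hwR⟩ : ∃ w ∈ connectedComponentIn Eᶜ y, w ∈ (Metric.closedBall (0 : V) R)ᶜ := by
      by_contra! hcon
      exact h y hy (isBounded_closedBall.subset fun w hw => not_not.1 (hcon w hw))
    have hwc := hW.isPreconnected.subset_connectedComponentIn hc hWE hwR
    rw [connectedComponentIn_eq hwc, ← connectedComponentIn_eq hwy]
    exact mem_connectedComponentIn hy
  rw [this]
  exact isPreconnected_connectedComponentIn

/-- A compact set with connected complement has arbitrarily small open neighbourhoods whose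
complement is connected. -/
theorem IsCompact.exists_isClosed_isPreconnected_compl {V : Type*} [NormedAddCommGroup V]
    [NormedSpace ℝ V] [ProperSpace V] (hV : 1 < Module.rank ℝ V) {E O : Set V} (hE : IsCompact E)
    (hEc : IsConnected Eᶜ) (hO : IsOpen O) (hEO : E ⊆ O) (hOb : Bornology.IsBounded O) :
    ∃ C, IsClosed C ∧ C.Nonempty ∧ IsPreconnected C ∧ Oᶜ ⊆ C ∧ C ⊆ Eᶜ := by
  obtain ⟨R, hR, hOR⟩ : ∃ R : ℝ, 0 ≤ R ∧ O ⊆ Metric.ball 0 R := by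
    obtain ⟨R, h⟩ := hOb.subset_ball 0
    exact ⟨max R 0, le_max_right _ _, h.trans (Metric.ball_subset_ball (le_max_left _ _))⟩
  obtain ⟨D, hD, hDc, hMD, hDE⟩ :=
    ((isCompact_closedBall (0 : V) (R + 1)).diff hO).exists_isCompact_isPreconnected_between
      hE.isClosed.isOpen_compl hEc (fun z hz hzE => hz.2 (hEO hzE))
  have hW := isConnected_compl_closedBall_of_one_lt_rank hV hR
  have : Nontrivial V := by
    rw [← rank_pos_iff_nontrivial (R := ℝ)]
    exact zero_lt_one.trans hV
  obtain ⟨p, hp⟩ := exists_norm_eq V (c := R + 1) (by linarith)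
  have hpW : p ∈ (Metric.closedBall (0 : V) R)ᶜ := by simp [hp]
  have hpD : p ∈ D := hMD ⟨by simp [hp], fun hpO => by have := hOR hpO; simp [hp] at this; linarith⟩
  have hWO : closure (Metric.closedBall (0 : V) R)ᶜ ⊆ (Metric.ball (0 : V) R)ᶜ :=
    closure_minimal (compl_subset_compl.2 Metric.ball_subset_closedBall) isOpen_ball.isClosed_compl
  refine ⟨closure (Metric.closedBall (0 : V) R)ᶜ ∪ D, isClosed_closure.union hD.isClosed,
    ⟨p, Or.inr hpD⟩, hW.isPreconnected.closure.union p (subset_closure hpW) hpD hDc, ?_,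
    union_subset (hWO.trans (compl_subset_compl.2 (hEO.trans hOR))) hDE⟩
  intro z hz
  by_cases hzR : z ∈ Metric.closedBall (0 : V) (R + 1)
  · exact Or.inr (hMD ⟨hzR, hz⟩)
  · exact Or.inl (subset_closure fun h => hzR (Metric.closedBall_subset_closedBall (by linarith) h))

/-- A component of a level set of a monotone function which stays in a compact subset of the
domain separates the space. -/
theorem LebMonotoneOn.not_isConnected_compl_connectedComponentIn {V : Type*}
    [NormedAddCommGroup V] [NormedSpace ℝ V] [ProperSpace V] (hV : 1 < Module.rank ℝ V)
    {Ω : Set V} (hΩ : IsOpen Ω) {u : V → ℝ} (hu : ContinuousOn u Ω) (hmono : LebMonotoneOn Ω u)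
    {t : ℝ} {x : V} (hx : x ∈ Ω) (hxt : u x = t)
    (hE : IsCompact (connectedComponentIn {x ∈ Ω | u x = t} x)) :
    ¬ IsConnected (connectedComponentIn {x ∈ Ω | u x = t} x)ᶜ := by
  intro hEc
  set L : Set V := {x ∈ Ω | u x = t}
  set E : Set V := connectedComponentIn L x
  have hxL : x ∈ L := ⟨hx, hxt⟩
  have hEΩ : E ⊆ Ω := (connectedComponentIn_subset L x).trans fun z hz => hz.1
  obtain ⟨O, hO, hEO, hOΩ, hOc⟩ := exists_open_between_and_isCompact_closure hE hΩ hEΩ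
  obtain ⟨C, hC, ⟨c, hc⟩, hCc, hOC, hCE⟩ := hE.exists_isClosed_isPreconnected_compl hV hEc hO hEO
    (hOc.isBounded.subset subset_closure)
  have hLO : IsCompact (closure O ∩ L) := by
    have : closure O ∩ L = closure O ∩ u ⁻¹' {t} := by
      ext z
      exact ⟨fun hz => ⟨hz.1, hz.2.2⟩, fun hz => ⟨hz.1, hOΩ hz.1, hz.2⟩⟩
    rw [this]
    exact hOc.of_isClosed_subset ((hu.mono hOΩ).preimage_isClosed_of_isClosed isClosed_closure
      isClosed_singleton) inter_subset_left
  have hxE : x ∈ E := mem_connectedComponentIn hxL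
  obtain ⟨F, F', hF, hF', hFF', hdisj, hxF, hFC⟩ :=
    hLO.exists_isCompact_of_connectedComponentIn_subset hC.isOpen_compl
      ⟨subset_closure (hEO hxE), hxL⟩
      ((connectedComponentIn_mono x inter_subset_right).trans (subset_compl_comm.1 hCE))
  obtain ⟨U₀, hU₀, hFU₀, hU₀C, -⟩ := exists_open_between_and_isCompact_closure hF
    (hC.isOpen_compl.inter hF'.isClosed.isOpen_compl)
    (fun z hz => ⟨hFC hz, Set.disjoint_left.1 hdisj hz⟩)
  set U := connectedComponentIn U₀ x
  set Z := connectedComponentIn Uᶜ c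
  have hU : IsOpen U := hU₀.connectedComponentIn
  have hZ : IsClosed Z := hU.isClosed_compl.isClosed_connectedComponentIn c
  have hCU : C ⊆ Uᶜ := fun z hz hzU =>
    (hU₀C (subset_closure (connectedComponentIn_subset _ _ hzU))).1 hz
  have hCZ : C ⊆ Z := hCc.subset_connectedComponentIn hc hCU
  have hZU : U ⊆ Zᶜ := subset_compl_comm.1 (connectedComponentIn_subset _ _)
  have hZO : Zᶜ ⊆ O := compl_subset_comm.1 (hOC.trans hCZ)
  have hxU : x ∈ U := mem_connectedComponentIn (hFU₀ hxF)
  have hfrU : frontier Z ⊆ frontier U :=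
    (frontier_connectedComponentIn_subset _ _).trans (frontier_compl U).subset
  have hclO : closure Zᶜ ⊆ closure O := closure_mono hZO
  have hfrZ : closure Zᶜ ∩ Z = frontier Z := by
    rw [frontier_eq_closure_inter_closure, hZ.closure_eq, inter_comm]
  have hfrL : ∀ z ∈ frontier Z, u z ≠ t := by
    intro z hz hzt
    have hzO : z ∈ closure O := hclO (hfrZ.symm ▸ hz : z ∈ closure Zᶜ ∩ Z).1
    have hz₀ : z ∈ frontier U₀ := frontier_connectedComponentIn_subset _ _ (hfrU hz)
    rcases (hFF'.symm ▸ ⟨hzO, hOΩ hzO, hzt⟩ : z ∈ F ∪ F') with hzF | hzF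
    · exact hz₀.2 (hU₀.interior_eq.symm ▸ hFU₀ hzF)
    · exact (hU₀C hz₀.1).2 hzF
  have hconn : IsPreconnected (frontier Z) := by
    rw [← hfrZ]
    refine isPreconnected_inter_of_union_eq_univ isClosed_closure hZ ?_
      isPreconnected_connectedComponentIn
      (isPreconnected_connectedComponentIn (F := U₀) (x := x)).closure (closure_mono hZU) ?_
    · exact eq_univ_of_subset (union_subset_union_left _ subset_closure) (compl_union_self Z)
    · rw [hfrZ]
      exact hfrU.trans frontier_subset_closure
  obtain ⟨⟨a, ha, hamax⟩, b, hb, hbmin⟩ := hmono Zᶜ hZ.isOpen_compl ⟨x, hZU hxU⟩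
    (hOc.of_isClosed_subset isClosed_closure hclO) (hclO.trans hOΩ)
  rw [frontier_compl] at ha hb
  have hcont : ContinuousOn u (frontier Z) := hu.mono
    (fun z hz => hOΩ (hclO (hfrZ.symm ▸ hz : z ∈ closure Zᶜ ∩ Z).1))
  have hxcl : x ∈ closure Zᶜ := subset_closure (hZU hxU)
  obtain ⟨z, hz, hzt⟩ := hconn.intermediate_value hb ha hcont
    ⟨hxt ▸ hbmin x hxcl, hxt ▸ hamax x hxcl⟩
  exact hfrL z hz hzt

/-- A connected set meeting both `s` and its complement meets the boundary of `s`. -/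
theorem IsPreconnected.inter_frontier_nonempty {X : Type*} [TopologicalSpace X] {S s : Set X}
    (hS : IsPreconnected S) (h : (S ∩ s).Nonempty) (h' : (S ∩ sᶜ).Nonempty) :
    (S ∩ frontier s).Nonempty := by
  rw [frontier_eq_closure_inter_closure]
  refine isPreconnected_closed_iff.1 hS _ _ isClosed_closure isClosed_closure ?_
    (h.mono (inter_subset_inter_right _ subset_closure))
    (h'.mono (inter_subset_inter_right _ subset_closure))
  exact (subset_univ S).trans
    (eq_univ_of_subset (union_subset_union subset_closure subset_closure) (union_compl_self s)).ge

/-- If `E` is closed and a bounded complementary component of `E` contains `z`, then no point of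
`E` is further from `z` than the diameter of `E`. -/
theorem IsClosed.edist_le_diam_of_mem_connectedComponentIn_compl {V : Type*}
    [NormedAddCommGroup V] [NormedSpace ℝ V] {E : Set V} (hE : IsClosed E) {x y z : V}
    (hx : x ∈ E) (hz : z ∈ connectedComponentIn Eᶜ y)
    (hb : Bornology.IsBounded (connectedComponentIn Eᶜ y)) : edist x z ≤ Metric.ediam E := by
  have hzE : z ∈ Eᶜ := connectedComponentIn_subset _ _ hz
  have hxz : z - x ≠ 0 := sub_ne_zero.2 fun h => hzE (h ▸ hx)
  have hpos : 0 < ‖z - x‖ := norm_pos_iff.2 hxz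
  have hray : IsPreconnected ((fun s : ℝ => z + s • (z - x)) '' Ici 0) :=
    isPreconnected_Ici.image _ (by fun_prop)
  obtain ⟨w, ⟨s, hs, rfl⟩, hw⟩ := hray.inter_frontier_nonempty
    (s := connectedComponentIn Eᶜ y) ⟨z, ⟨0, by simp, by simp⟩, hz⟩ (by
      rw [inter_compl_nonempty_iff]
      intro hsub
      obtain ⟨R, hR⟩ := hb.subset_closedBall z
      have h := hR (hsub ⟨(|R| + 1) / ‖z - x‖, mem_Ici.2 (by positivity), rfl⟩)
      simp only [Metric.mem_closedBall, dist_self_add_left, norm_smul] at h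
      rw [Real.norm_of_nonneg (by positivity), div_mul_cancel₀ _ hpos.ne'] at h
      linarith [le_abs_self R])
  have hwE : z + s • (z - x) ∈ E := by
    have := frontier_connectedComponentIn_subset _ _ hw
    rw [frontier_compl] at this
    exact hE.frontier_subset this
  refine le_trans ?_ (Metric.edist_le_ediam_of_mem hx hwE)
  rw [edist_dist, edist_dist]
  refine ENNReal.ofReal_le_ofReal ?_
  have : x - (z + s • (z - x)) = -((1 + s) • (z - x)) := by module
  rw [dist_eq_norm, dist_eq_norm, this, norm_neg, norm_smul, norm_sub_rev,
    Real.norm_of_nonneg (by linarith [mem_Ici.1 hs])]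
  nlinarith [mem_Ici.1 hs]

/-- each component `E` of a level set of a continuous monotone function
either exits all compact subsets of `Ω`, or `ℝ² \ E` has a bounded component and every
bounded component of `ℝ² \ E` meets `∂Ω`; in particular
`diam E ≥ sup_{x ∈ E} dist(x, ∂Ω) > 0`. -/
theorem level_set_component_dichotomy
    (Ω : Set (EuclideanSpace ℝ (Fin 2))) (hΩ : IsOpen Ω)
    (u : EuclideanSpace ℝ (Fin 2) → ℝ) (hu : ContinuousOn u Ω)
    (hmono : LebMonotoneOn Ω u)
    (t : ℝ) (x₀ : EuclideanSpace ℝ (Fin 2)) (hx₀ : x₀ ∈ Ω) (hx₀t : u x₀ = t)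
    (E : Set (EuclideanSpace ℝ (Fin 2))) (hE : E = connectedComponentIn {x ∈ Ω | u x = t} x₀) :
    ((∀ K : Set (EuclideanSpace ℝ (Fin 2)), IsCompact K → K ⊆ Ω → ¬ E ⊆ K) ∨
      ((∃ y ∈ Eᶜ, Bornology.IsBounded (connectedComponentIn Eᶜ y)) ∧
        ∀ y ∈ Eᶜ, Bornology.IsBounded (connectedComponentIn Eᶜ y) →
          (connectedComponentIn Eᶜ y ∩ frontier Ω).Nonempty)) ∧
    (⨆ x ∈ E, EMetric.infEdist x (frontier Ω)) ≤ EMetric.diam E ∧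
    0 < ⨆ x ∈ E, EMetric.infEdist x (frontier Ω) := by
  have hV : 1 < Module.rank ℝ (EuclideanSpace ℝ (Fin 2)) := by
    rw [← Module.finrank_eq_rank, finrank_euclideanSpace_fin]
    norm_num
  have hxL : x₀ ∈ {x ∈ Ω | u x = t} := ⟨hx₀, hx₀t⟩
  have hEL : E ⊆ {x ∈ Ω | u x = t} := hE ▸ connectedComponentIn_subset _ _
  have hxE : x₀ ∈ E := hE ▸ mem_connectedComponentIn hxL
  have hpos : 0 < ⨆ x ∈ E, Metric.infEDist x (frontier Ω) := by
    have h : 0 < Metric.infEDist x₀ (frontier Ω) := by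
      rw [Metric.infEDist_pos_iff_notMem_closure, isClosed_frontier.closure_eq, hΩ.frontier_eq]
      exact fun h => h.2 hx₀
    exact h.trans_le (le_iSup₂ (f := fun x (_ : x ∈ E) => Metric.infEDist x (frontier Ω)) x₀ hxE)
  by_cases hK : ∀ K : Set (EuclideanSpace ℝ (Fin 2)), IsCompact K → K ⊆ Ω → ¬ E ⊆ K
  · refine ⟨Or.inl hK, iSup₂_le fun x hx => ?_, hpos⟩
    by_cases hb : Bornology.IsBounded E
    · obtain ⟨z, hz, hzΩ⟩ := not_subset.1 fun h => hK _ hb.isCompact_closure h subset_closure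
      have hzf : z ∈ frontier Ω := by
        rw [hΩ.frontier_eq]
        exact ⟨closure_mono (fun w hw => (hEL hw).1) hz, hzΩ⟩
      change Metric.infEDist x (frontier Ω) ≤ Metric.ediam E
      rw [← Metric.ediam_closure]
      exact (Metric.infEDist_le_edist_of_mem hzf).trans
        (Metric.edist_le_ediam_of_mem (subset_closure hx) hz)
    · rw [Metric.isBounded_iff_ediam_ne_top, not_not] at hb
      exact le_top.trans hb.ge
  · push Not at hK
    obtain ⟨K, hKc, hKΩ, hEK⟩ := hK
    have hEc : IsCompact E := by
      have hLK : IsClosed (K ∩ u ⁻¹' {t}) :=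
        (hu.mono hKΩ).preimage_isClosed_of_isClosed hKc.isClosed isClosed_singleton
      refine hKc.of_isClosed_subset (isClosed_of_closure_subset ?_) hEK
      have hcl : closure E ⊆ K ∩ u ⁻¹' {t} :=
        closure_minimal (fun z hz => ⟨hEK hz, (hEL hz).2⟩) hLK
      have hpre : IsPreconnected E := hE ▸ isPreconnected_connectedComponentIn
      exact (hpre.closure.subset_connectedComponentIn
        (F := {x ∈ Ω | u x = t}) (subset_closure hxE)
        (fun z hz => ⟨hKΩ (hcl hz).1, (hcl hz).2⟩)).trans hE.ge
    have hex : ∃ y ∈ Eᶜ, Bornology.IsBounded (connectedComponentIn Eᶜ y) := by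
      by_contra! hcon
      have h := hEc.isBounded.isConnected_compl_of_forall_not_isBounded hV hcon
      subst hE
      exact hmono.not_isConnected_compl_connectedComponentIn hV hΩ hu hx₀ hx₀t hEc h
    have hmeet : ∀ y ∈ Eᶜ, Bornology.IsBounded (connectedComponentIn Eᶜ y) →
        (connectedComponentIn Eᶜ y ∩ frontier Ω).Nonempty := by
      intro y hy hb
      by_contra hne
      set W := connectedComponentIn Eᶜ y with hW
      have hyW : y ∈ W := mem_connectedComponentIn hy
      have hWo : IsOpen W := hEc.isClosed.isOpen_compl.connectedComponentIn
      have hWc : IsCompact (closure W) := hb.isCompact_closure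
      have hfrE : frontier W ⊆ E := by
        refine (frontier_connectedComponentIn_subset _ _).trans ?_
        rw [frontier_compl]
        exact hEc.isClosed.frontier_subset
      have hfrne : (frontier W).Nonempty := by
        rw [nonempty_frontier_iff]
        exact ⟨⟨y, hyW⟩, fun h => connectedComponentIn_subset _ _
          (hW ▸ h ▸ mem_univ x₀ : x₀ ∈ connectedComponentIn Eᶜ y) hxE⟩
      obtain ⟨z, hz⟩ := hfrne
      obtain ⟨w, hwΩ, hwW⟩ := mem_closure_iff.1 hz.1 Ω hΩ (hEL (hfrE hz)).1
      have hWΩ : W ⊆ Ω := by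
        by_contra hsub
        have hWp : IsPreconnected W := isPreconnected_connectedComponentIn
        obtain ⟨v, hv⟩ := hWp.inter_frontier_nonempty
          ⟨w, hwW, hwΩ⟩ (inter_compl_nonempty_iff.2 hsub)
        exact hne ⟨v, hv⟩
      have hclΩ : closure W ⊆ Ω := by
        rw [closure_eq_self_union_frontier]
        exact union_subset hWΩ (hfrE.trans fun z hz => (hEL hz).1)
      obtain ⟨⟨a, ha, hamax⟩, b, hb', hbmin⟩ := hmono W hWo ⟨y, hyW⟩ hWc hclΩ
      have hclL : closure W ⊆ {x ∈ Ω | u x = t} := fun v hv =>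
        ⟨hclΩ hv, le_antisymm ((hamax v hv).trans (hEL (hfrE ha)).2.le)
          ((hEL (hfrE hb')).2.ge.trans (hbmin v hv))⟩
      have hpre : IsPreconnected E := hE ▸ isPreconnected_connectedComponentIn
      have hWpre : IsPreconnected (closure W) := isPreconnected_connectedComponentIn.closure
      have hsub := (hpre.union z (hfrE hz) hz.1 hWpre).subset_connectedComponentIn
        (Or.inl hxE) (union_subset hEL hclL)
      exact hy (hE ▸ hsub (Or.inr (subset_closure hyW)))
    refine ⟨Or.inr ⟨hex, hmeet⟩, iSup₂_le fun x hx => ?_, hpos⟩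
    obtain ⟨y, hy, hb⟩ := hex
    obtain ⟨z, hz, hzf⟩ := hmeet y hy hb
    exact (Metric.infEDist_le_edist_of_mem hzf).trans
      (hEc.isClosed.edist_le_diam_of_mem_connectedComponentIn_compl hx hz hb)
end

section
/- Let Ω ⊆ ℝ² be open and simply connected and u : Ω → ℝ continuous. Then u is monotone in Ω if and only if every connected component of every level set of u exits all compact subsets of Ω. -/
open Set Metric

/-- `z ↦ z - p` has a continuous logarithm on `A`. -/
def HasContinuousLog (A : Set ℂ) (p : ℂ) : Prop :=
  ∃ g : ℂ → ℂ, ContinuousOn g A ∧ ∀ z ∈ A, Complex.exp (g z) = z - p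

namespace HasContinuousLog

variable {A B : Set ℂ} {p q : ℂ}

theorem mono (h : HasContinuousLog B p) (hAB : A ⊆ B) : HasContinuousLog A p := by
  obtain ⟨g, hg, hgp⟩ := h
  exact ⟨g, hg.mono hAB, fun z hz => hgp z (hAB hz)⟩

theorem of_isSimplyConnected (hA : IsSimplyConnected A) (hAo : IsOpen A) (hp : p ∉ A) :
    HasContinuousLog A p := by
  obtain ⟨g, hg, hgp⟩ := Complex.exists_continuousOn_eqOn_exp_comp hA hAo
    (g := fun z => z - p) (by fun_prop) (by
      rintro ⟨z, hz, hzp⟩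
      exact hp (sub_eq_zero.mp hzp ▸ hz))
  exact ⟨g, hg, hgp⟩

theorem of_norm_sub_lt (h : HasContinuousLog A p) (hpq : ∀ z ∈ A, ‖q - p‖ < ‖z - p‖) :
    HasContinuousLog A q := by
  obtain ⟨g, hg, hgp⟩ := h
  have hne : ∀ z ∈ A, z - p ≠ 0 := fun z hz =>
    norm_pos_iff.mp ((norm_nonneg _).trans_lt (hpq z hz))
  have hslit : ∀ z ∈ A, 1 + (p - q) / (z - p) ∈ Complex.slitPlane := fun z hz => by
    apply Complex.mem_slitPlane_of_norm_lt_one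
    rw [norm_div, norm_sub_rev, div_lt_one (norm_pos_iff.mpr (hne z hz))]
    exact hpq z hz
  refine ⟨fun z => g z + Complex.log (1 + (p - q) / (z - p)), hg.add ?_, fun z hz => ?_⟩
  · refine ContinuousOn.clog ?_ hslit
    exact continuousOn_const.add (continuousOn_const.div (by fun_prop) hne)
  · rw [Complex.exp_add, hgp z hz, Complex.exp_log (Complex.slitPlane_ne_zero (hslit z hz))]
    field_simp [hne z hz]
    ring

theorem of_norm_lt (hq : ∀ z ∈ A, ‖z‖ < ‖q‖) : HasContinuousLog A q := by
  by_cases hq0 : q = 0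
  · refine ⟨fun _ => 0, continuousOn_const, fun z hz => ?_⟩
    exact absurd (hq z hz) (by simp [hq0])
  have hslit : ∀ z ∈ A, 1 + -z / q ∈ Complex.slitPlane := fun z hz => by
    apply Complex.mem_slitPlane_of_norm_lt_one
    rw [norm_div, norm_neg, div_lt_one (norm_pos_iff.mpr hq0)]
    exact hq z hz
  refine ⟨fun z => Complex.log (-q) + Complex.log (1 + -z / q),
    continuousOn_const.add (ContinuousOn.clog (by fun_prop) hslit), fun z hz => ?_⟩
  rw [Complex.exp_add, Complex.exp_log (neg_ne_zero.mpr hq0),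
    Complex.exp_log (Complex.slitPlane_ne_zero (hslit z hz))]
  field_simp
  ring

theorem union (hA : HasContinuousLog A p) (hB : HasContinuousLog B p) (hAc : IsClosed A)
    (hBc : IsClosed B) (hAB : Disjoint A B) : HasContinuousLog (A ∪ B) p := by
  classical
  obtain ⟨g, hg, hgp⟩ := hA
  obtain ⟨k, hk, hkp⟩ := hB
  have hgB : EqOn (A.piecewise g k) k B := fun z hz =>
    piecewise_eq_of_notMem _ _ _ (hAB.notMem_of_mem_right hz)
  refine ⟨A.piecewise g k, ContinuousOn.union_of_isClosed
    (hg.congr (piecewise_eqOn _ _ _)) (hk.congr hgB) hAc hBc, ?_⟩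
  rintro z (hz | hz)
  · rw [piecewise_eq_of_mem _ _ _ hz, hgp z hz]
  · rw [hgB hz, hkp z hz]

end HasContinuousLog

theorem not_hasContinuousLog_sphere (p : ℂ) {R : ℝ} (hR : 0 < R) :
    ¬ HasContinuousLog (sphere p R) p := by
  rintro ⟨g, hg, hgp⟩
  have hmem : ∀ θ : ℝ, circleMap p R θ ∈ sphere p R := circleMap_mem_sphere p hR.le
  have hc : Continuous fun θ : ℝ => g (circleMap p R θ) - θ * Complex.I :=
    (hg.comp_continuous (continuous_circleMap p R) hmem).sub (by fun_prop)
  have hexp : ∀ θ : ℝ, Complex.exp (g (circleMap p R θ) - θ * Complex.I) = R := fun θ => by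
    rw [Complex.exp_sub, hgp _ (hmem θ), circleMap, add_sub_cancel_left,
      mul_div_cancel_right₀ _ (Complex.exp_ne_zero _)]
  have := Complex.isCoveringMap_exp.const_of_comp hc
    (fun a b => Subtype.ext ((hexp a).trans (hexp b).symm)) 0 (2 * Real.pi)
  have hper : circleMap p R (2 * Real.pi) = circleMap p R 0 := by
    simpa using periodic_circleMap p R 0
  simp [hper, sub_eq_add_neg, Real.pi_ne_zero] at this

/-- The frontier of a bounded set containing `p` separates `p` from infinity, so `z ↦ z - p` has no
continuous logarithm on that frontier. -/
theorem not_hasContinuousLog_frontier {V : Set ℂ} (hVb : Bornology.IsBounded V)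
    {p : ℂ} (hp : p ∈ V) : ¬ HasContinuousLog (frontier V) p := by
  classical
  rintro ⟨g, hg, hgp⟩
  obtain ⟨k, hk⟩ := ContinuousMap.exists_restrict_eq (isClosed_frontier (s := V))
    ⟨(frontier V).domRestrict g, hg.domRestrict⟩
  have hkg : ∀ z ∈ frontier V, k z = g z := fun z hz => DFunLike.congr_fun hk ⟨z, hz⟩
  have hF : Continuous (V.piecewise (fun z => Complex.exp (k z)) (fun z => z - p)) := by
    refine Continuous.piecewise (fun z hz => ?_) (by fun_prop) (by fun_prop)
    rw [hkg z hz, hgp z hz]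
  obtain ⟨G, hG, hGF⟩ := Complex.exists_continuousOn_eqOn_exp_comp (X := ℂ) (U := univ)
    (Homeomorph.Set.univ ℂ).toHomotopyEquiv.simplyConnectedSpace isOpen_univ hF.continuousOn (by
      rintro ⟨z, -, hz⟩
      by_cases hzV : z ∈ V
      · simp [hzV] at hz
      · simp only [piecewise_eq_of_notMem _ _ _ hzV, sub_eq_zero] at hz
        exact hzV (hz ▸ hp))
  obtain ⟨R, hR, hVR⟩ := hVb.subset_ball_lt 0 p
  refine not_hasContinuousLog_sphere p hR ⟨G, hG.mono (subset_univ _), fun z hz => ?_⟩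
  have hzV : z ∉ V := fun h => (mem_ball.mp (hVR h)).ne hz
  simpa [hzV] using hGF (mem_univ z)

/-- The points of `Aᶜ` separated from infinity by `A`. -/
def separatedByCompact (A : Set ℂ) : Set ℂ := {q | q ∉ A ∧ ¬ HasContinuousLog A q}

theorem eventually_hasContinuousLog_iff {A : Set ℂ} (hA : IsClosed A) {q : ℂ} (hq : q ∉ A) :
    ∀ᶠ q' in nhds q, (q' ∉ A ∧ (HasContinuousLog A q' ↔ HasContinuousLog A q)) := by
  obtain ⟨r, hr, hrA⟩ := Metric.isOpen_iff.mp hA.isOpen_compl q hq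
  have hz : ∀ z ∈ A, r ≤ ‖z - q‖ := fun z hz => by
    by_contra! h
    exact hrA (mem_ball_iff_norm.mpr h) hz
  filter_upwards [Metric.ball_mem_nhds q (half_pos hr)] with q' hq'
  rw [mem_ball_iff_norm] at hq'
  refine ⟨fun h => by linarith [hz q' h], fun h => h.of_norm_sub_lt fun z hzA => ?_,
    fun h => h.of_norm_sub_lt fun z hzA => by linarith [hz z hzA]⟩
  have := norm_sub_le_norm_sub_add_norm_sub z q' q
  rw [norm_sub_rev q q']
  linarith [hz z hzA]

theorem isOpen_separatedByCompact {A : Set ℂ} (hA : IsClosed A) :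
    IsOpen (separatedByCompact A) := by
  rw [isOpen_iff_mem_nhds]
  rintro q ⟨hq, hql⟩
  filter_upwards [eventually_hasContinuousLog_iff hA hq] with q' hq'
  exact ⟨hq'.1, fun h => hql (hq'.2.mp h)⟩

theorem frontier_separatedByCompact_subset {A : Set ℂ} (hA : IsClosed A) :
    frontier (separatedByCompact A) ⊆ A := by
  intro q hq
  by_contra hqA
  rw [(isOpen_separatedByCompact hA).frontier_eq] at hq
  obtain ⟨q', hq', hq's⟩ := (mem_closure_iff_frequently.mp hq.1).and_eventually
    (eventually_hasContinuousLog_iff hA hqA) |>.exists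
  exact hq.2 ⟨hqA, fun h => hq'.2 (hq's.2.mpr h)⟩

theorem isBounded_separatedByCompact {A : Set ℂ} (hA : Bornology.IsBounded A) :
    Bornology.IsBounded (separatedByCompact A) := by
  obtain ⟨R, hR⟩ := hA.subset_ball 0
  refine (isBounded_closedBall (x := (0 : ℂ)) (r := R)).subset fun q hq => ?_
  by_contra! h
  rw [mem_closedBall_zero_iff, not_le] at h
  exact hq.2 (.of_norm_lt fun z hz => (mem_ball_zero_iff.mp (hR hz)).trans h)

/-- If two disjoint compact sets together form the frontier of a bounded open set `V`, then one
of them already bounds an open neighbourhood of a given point of `V`. -/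
theorem exists_isOpen_frontier_subset_or_complex {Ω V A B : Set ℂ} (hΩ : IsOpen Ω)
    (hsc : IsSimplyConnected Ω) (hV : IsOpen V) (hVb : Bornology.IsBounded V)
    (hA : IsCompact A) (hB : IsCompact B) (hAB : Disjoint A B) (hAΩ : A ⊆ Ω) (hBΩ : B ⊆ Ω)
    (hfr : frontier V = A ∪ B) {p : ℂ} (hp : p ∈ V) :
    ∃ W : Set ℂ, IsOpen W ∧ Bornology.IsBounded W ∧ p ∈ W ∧ W ⊆ Ω ∧
      (frontier W ⊆ A ∨ frontier W ⊆ B) := by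
  have hp_fr : p ∉ A ∪ B := hfr ▸ fun h => (hV.frontier_eq ▸ h).2 hp
  have hsub : ∀ {D : Set ℂ}, D ⊆ Ω → separatedByCompact D ⊆ Ω := fun hD q hq => by
    by_contra hqΩ
    exact hq.2 ((HasContinuousLog.of_isSimplyConnected hsc hΩ hqΩ).mono hD)
  by_cases hlog : HasContinuousLog A p
  · have hlogB : ¬ HasContinuousLog B p := fun h =>
      not_hasContinuousLog_frontier hVb hp
        (hfr ▸ hlog.union h hA.isClosed hB.isClosed hAB)
    exact ⟨_, isOpen_separatedByCompact hB.isClosed, isBounded_separatedByCompact hB.isBounded,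
      ⟨fun h => hp_fr (.inr h), hlogB⟩, hsub hBΩ,
      .inr (frontier_separatedByCompact_subset hB.isClosed)⟩
  · exact ⟨_, isOpen_separatedByCompact hA.isClosed, isBounded_separatedByCompact hA.isBounded,
      ⟨fun h => hp_fr (.inl h), hlog⟩, hsub hAΩ,
      .inl (frontier_separatedByCompact_subset hA.isClosed)⟩

theorem exists_isOpen_frontier_subset_or {Ω V A B : Set (EuclideanSpace ℝ (Fin 2))}
    (hΩ : IsOpen Ω) (hsc : IsSimplyConnected Ω) (hV : IsOpen V) (hVb : Bornology.IsBounded V)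
    (hA : IsCompact A) (hB : IsCompact B) (hAB : Disjoint A B) (hAΩ : A ⊆ Ω) (hBΩ : B ⊆ Ω)
    (hfr : frontier V = A ∪ B) {p : EuclideanSpace ℝ (Fin 2)} (hp : p ∈ V) :
    ∃ W : Set (EuclideanSpace ℝ (Fin 2)), IsOpen W ∧ Bornology.IsBounded W ∧ p ∈ W ∧ W ⊆ Ω ∧
      (frontier W ⊆ A ∨ frontier W ⊆ B) := by
  let e : EuclideanSpace ℝ (Fin 2) ≃ₗᵢ[ℝ] ℂ := Complex.orthonormalBasisOneI.repr.symm
  let h : EuclideanSpace ℝ (Fin 2) ≃ₜ ℂ := e.toHomeomorph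
  obtain ⟨W, hW, hWb, hpW, hWΩ, hWfr⟩ := exists_isOpen_frontier_subset_or_complex
    (h.isOpenMap _ hΩ) (h.isSimplyConnected_image.mpr hsc) (h.isOpenMap _ hV)
    (e.lipschitz.isBounded_image hVb) (hA.image h.continuous) (hB.image h.continuous)
    ((disjoint_image_iff h.injective).mpr hAB) (image_mono hAΩ) (image_mono hBΩ)
    (by rw [← h.image_frontier, hfr, image_union]) (mem_image_of_mem h hp)
  refine ⟨h ⁻¹' W, hW.preimage h.continuous, ?_, hpW, ?_, ?_⟩
  · exact e.antilipschitz.isBounded_preimage hWb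
  · exact (preimage_mono hWΩ).trans (preimage_image_eq _ h.injective).subset
  · rw [← h.preimage_frontier]
    exact hWfr.imp (fun k => (preimage_mono k).trans (preimage_image_eq _ h.injective).subset)
      (fun k => (preimage_mono k).trans (preimage_image_eq _ h.injective).subset)

/-- A component of a compact set that lies in an open set `O` can be isolated inside `O`
by an open set whose frontier misses the compact set. -/
theorem exists_isOpen_disjoint_frontier_of_connectedComponentIn_subset {E : Type*}
    [TopologicalSpace E] [T2Space E] [LocallyCompactSpace E] {X O : Set E} (hX : IsCompact X)
    {x : E} (hx : x ∈ X) (hO : IsOpen O) (hxO : connectedComponentIn X x ⊆ O) :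
    ∃ V : Set E, IsOpen V ∧ x ∈ V ∧ closure V ⊆ O ∧ IsCompact (closure V) ∧
      Disjoint (frontier V) X := by
  have : CompactSpace X := isCompact_iff_compactSpace.mp hX
  have hO' : IsOpen ((↑) ⁻¹' O : Set X) := hO.preimage continuous_subtype_val
  rw [connectedComponentIn_eq_image hx, image_subset_iff,
    connectedComponent_eq_iInter_isClopen] at hxO
  have : Nonempty { s : Set X // IsClopen s ∧ ⟨x, hx⟩ ∈ s } := ⟨⟨univ, isClopen_univ, mem_univ _⟩⟩
  obtain ⟨⟨Z, hZ, hxZ⟩, hZO⟩ := exists_subset_nhds_of_compactSpace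
    (V := fun s : { s : Set X // IsClopen s ∧ ⟨x, hx⟩ ∈ s } => s.1)
    (fun s t => ⟨⟨s ∩ t, s.2.1.inter t.2.1, s.2.2, t.2.2⟩, inter_subset_left, inter_subset_right⟩)
    (fun s => s.2.1.isClosed) (fun z hz => hO'.mem_nhds (hxO hz))
  have himage : ∀ Y : Set X, IsClosed Y → IsCompact ((↑) '' Y : Set E) := fun Y hY =>
    hY.isCompact.image continuous_subtype_val
  obtain ⟨V, hV, hZV, hVO, hVc⟩ := exists_open_between_and_isCompact_closure
    (himage Z hZ.isClosed)
    (hO.inter (himage Zᶜ hZ.isOpen.isClosed_compl).isClosed.isOpen_compl)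
    (by
      rintro _ ⟨z, hz, rfl⟩
      refine ⟨hZO hz, ?_⟩
      rintro ⟨w, hw, hwz⟩
      exact hw (Subtype.ext hwz ▸ hz))
  refine ⟨V, hV, hZV ⟨_, hxZ, rfl⟩, hVO.trans inter_subset_left, hVc, ?_⟩
  rw [disjoint_left]
  intro y hy hyX
  by_cases hyZ : (⟨y, hyX⟩ : X) ∈ Z
  · exact (hV.frontier_eq ▸ hy).2 (hZV ⟨_, hyZ, rfl⟩)
  · exact (hVO (frontier_subset_closure hy)).2 ⟨_, hyZ, rfl⟩

theorem exists_mem_frontier_of_not_connectedComponentIn_subset {E : Type*} [TopologicalSpace E]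
    {F U : Set E} (hU : IsOpen U) {p : E} (hpU : p ∈ U) (hpF : p ∈ F)
    (h : ¬ connectedComponentIn F p ⊆ closure U) : ∃ q ∈ frontier U, q ∈ F := by
  by_contra! hfr
  refine h ((isPreconnected_connectedComponentIn.subset_of_closure_inter_subset hU
    ⟨p, mem_connectedComponentIn hpF, hpU⟩ ?_).trans subset_closure)
  rintro q ⟨hqU, hqF⟩
  by_contra hq
  exact hfr q (hU.frontier_eq ▸ ⟨hqU, hq⟩) (connectedComponentIn_subset _ _ hqF)

theorem lebMonotoneOn_of_level_components_escape {E : Type*} [TopologicalSpace E] {Ω : Set E}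
    {u : E → ℝ} (hu : ContinuousOn u Ω)
    (h : ∀ t : ℝ, ∀ x ∈ Ω, u x = t → ∀ K : Set E, IsCompact K → K ⊆ Ω →
      ¬ connectedComponentIn {y ∈ Ω | u y = t} x ⊆ K) : LebMonotoneOn Ω u := by
  intro U hU hUne hUc hUΩ
  have hfr : ∀ p ∈ closure U, ∃ q ∈ frontier U, u q = u p := fun p hp => by
    by_cases hpU : p ∈ U
    · obtain ⟨q, hq, -, hqp⟩ := exists_mem_frontier_of_not_connectedComponentIn_subset hU hpU
        (⟨hUΩ hp, rfl⟩ : p ∈ {y ∈ Ω | u y = u p}) (h _ p (hUΩ hp) rfl _ hUc hUΩ)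
      exact ⟨q, hq, hqp⟩
    · exact ⟨p, hU.frontier_eq ▸ ⟨hp, hpU⟩, rfl⟩
  constructor
  · obtain ⟨p, hp, hmax⟩ := hUc.exists_isMaxOn hUne.closure (hu.mono hUΩ)
    obtain ⟨q, hq, hqp⟩ := hfr p hp
    exact ⟨q, hq, fun y hy => hqp ▸ hmax hy⟩
  · obtain ⟨p, hp, hmin⟩ := hUc.exists_isMinOn hUne.closure (hu.mono hUΩ)
    obtain ⟨q, hq, hqp⟩ := hfr p hp
    exact ⟨q, hq, fun y hy => hqp ▸ hmin hy⟩

/-- on an open simply connected `Ω ⊆ ℝ²`, a continuous `u` is monotone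
iff every component of every level set of `u` exits all compact subsets of `Ω`. -/
theorem lebMonotoneOn_iff_level_components_escape
    (Ω : Set (EuclideanSpace ℝ (Fin 2))) (hΩ : IsOpen Ω)
    (hsc : SimplyConnectedSpace ↥Ω)
    (u : EuclideanSpace ℝ (Fin 2) → ℝ) (hu : ContinuousOn u Ω) :
    LebMonotoneOn Ω u ↔
      ∀ t : ℝ, ∀ x ∈ Ω, u x = t →
        ∀ K : Set (EuclideanSpace ℝ (Fin 2)), IsCompact K → K ⊆ Ω →
          ¬ connectedComponentIn {y ∈ Ω | u y = t} x ⊆ K := by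
  refine ⟨fun hmono t x hx hxt K hK hKΩ hcomp => ?_, lebMonotoneOn_of_level_components_escape hu⟩
  obtain ⟨L, hL, hKL, hLΩ⟩ := exists_compact_between hK hΩ hKΩ
  have hxL : x ∈ L := interior_subset
    (hKL (hcomp (mem_connectedComponentIn (F := {y ∈ Ω | u y = t}) ⟨hx, hxt⟩)))
  have hX : IsCompact (L ∩ u ⁻¹' {t}) := hL.of_isClosed_subset
    ((hu.mono hLΩ).preimage_isClosed_of_isClosed hL.isClosed isClosed_singleton)
    inter_subset_left
  obtain ⟨V, hV, hxV, hVL, hVc, hVX⟩ :=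
    exists_isOpen_disjoint_frontier_of_connectedComponentIn_subset hX ⟨hxL, hxt⟩ isOpen_interior
      ((connectedComponentIn_mono x (inter_subset_inter_left _ hLΩ)).trans (hcomp.trans hKL))
  have hfrL : frontier V ⊆ L := frontier_subset_closure.trans (hVL.trans interior_subset)
  have hfrt : ∀ y ∈ frontier V, u y ≠ t := fun y hy hyt =>
    disjoint_left.mp hVX hy ⟨hfrL hy, hyt⟩
  have hcpt : ∀ S : Set ℝ, IsClosed S → IsCompact (frontier V ∩ u ⁻¹' S) := fun S hS =>
    hL.of_isClosed_subset ((hu.mono (hfrL.trans hLΩ)).preimage_isClosed_of_isClosed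
      isClosed_frontier hS) (inter_subset_left.trans hfrL)
  have hsub : ∀ S : Set ℝ, frontier V ∩ u ⁻¹' S ⊆ Ω := fun S =>
    inter_subset_left.trans (hfrL.trans hLΩ)
  obtain ⟨W, hW, hWb, hxW, hWΩ, hWfr⟩ := exists_isOpen_frontier_subset_or hΩ hsc hV
    (hVc.isBounded.subset subset_closure) (hcpt _ isClosed_Ici) (hcpt _ isClosed_Iic)
    (disjoint_left.mpr fun y hy hy' => hfrt y hy.1 (le_antisymm hy'.2 hy.2))
    (hsub (Ici t)) (hsub (Iic t))
    (by rw [← inter_union_distrib_left, ← preimage_union, union_comm, Iic_union_Ici,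
      preimage_univ, inter_univ]) hxV
  have hWcl : closure W ⊆ Ω := by
    rw [closure_eq_self_union_frontier]
    exact union_subset hWΩ (hWfr.elim (·.trans (hsub _)) (·.trans (hsub _)))
  obtain ⟨⟨a, ha, hamax⟩, b, hb, hbmin⟩ := hmono W hW ⟨x, hxW⟩ hWb.isCompact_closure hWcl
  have hta := hxt ▸ hamax x (subset_closure hxW)
  have hbt := hxt ▸ hbmin x (subset_closure hxW)
  rcases hWfr with h | h
  · exact hfrt b (h hb).1 (le_antisymm hbt (h hb).2)
  · exact hfrt a (h ha).1 (le_antisymm (h ha).2 hta)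
end

section
/- There is no uncountable collection of pairwise disjoint compact subsets of ℝ² each of which contains a junction point (a triod): i.e., any family of pairwise disjoint compact sets in the plane, each containing three Jordan arcs meeting at a single common point but otherwise pairwise disjoint, is at most countable. -/
open Set Metric

open scoped unitInterval

/-- The standard triod: the union of the unit segments of the three coordinate axes of `ℝ³`. -/
def StandardTriod : Set (Fin 3 → ℝ) :=
  {v | ∃ (i : Fin 3) (t : I), v = Pi.single i (t : ℝ)}

namespace StandardTriod

/-- The point of the `i`-th leg at parameter `t`. -/
def leg (i : Fin 3) (t : I) : StandardTriod := ⟨Pi.single i (t : ℝ), i, t, rfl⟩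

theorem exists_eq_leg (p : StandardTriod) : ∃ i t, p = leg i t := by
  obtain ⟨v, i, t, rfl⟩ := p
  exact ⟨i, t, rfl⟩

theorem continuous_leg (i : Fin 3) : Continuous (leg i) :=
  Continuous.subtype_mk
    ((continuous_single (A := fun _ : Fin 3 ↦ ℝ) i).comp continuous_subtype_val) _

theorem leg_zero (i j : Fin 3) : leg i 0 = leg j 0 := by
  simp [leg]

theorem leg_ne_leg {i j : Fin 3} (hij : i ≠ j) (t : I) : leg i 1 ≠ leg j t := by
  intro h
  have := congrFun (congrArg Subtype.val h) i
  simp [leg, hij] at this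

instance : CompactSpace StandardTriod := by
  have : range (fun x : Fin 3 × I ↦ leg x.1 x.2) = univ :=
    eq_univ_of_forall fun p ↦ by
      obtain ⟨i, t, rfl⟩ := exists_eq_leg p
      exact ⟨(i, t), rfl⟩
  rw [← isCompact_univ_iff, ← this]
  exact isCompact_range (continuous_prod_of_discrete_left.2 continuous_leg)

/-- The contraction of the standard triod to its centre. -/
def contract (r : I) (p : StandardTriod) : StandardTriod :=
  ⟨(r : ℝ) • p.1, by
    obtain ⟨i, t, h⟩ := p.2
    exact ⟨i, r * t, by rw [h, ← Pi.single_smul]; rfl⟩⟩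

theorem continuous_contract : Continuous fun x : I × StandardTriod ↦ contract x.1 x.2 :=
  Continuous.subtype_mk (by fun_prop) _

theorem contract_one (p : StandardTriod) : contract 1 p = p :=
  Subtype.ext (by simp [contract])

theorem contract_zero (p : StandardTriod) : contract 0 p = leg 0 0 :=
  Subtype.ext (by simp [contract, leg])

/-- The difference of two maps with disjoint images has a continuous logarithm, since the square
of the standard triod is contractible. -/
theorem exists_exp_eq_sub (f g : C(StandardTriod, ℂ)) (hfg : ∀ p q, f p ≠ g q) :
    ∃ L : C(StandardTriod × StandardTriod, ℂ), ∀ p q, Complex.exp (L (p, q)) = f p - g q := by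
  let H : C(I × (StandardTriod × StandardTriod), {z : ℂ // z ≠ 0}) :=
    ⟨fun x ↦ ⟨f (contract x.1 x.2.1) - g (contract x.1 x.2.2), sub_ne_zero.2 (hfg _ _)⟩,
      Continuous.subtype_mk
        ((f.continuous.comp (continuous_contract.comp (by fun_prop :
            Continuous fun x : I × (StandardTriod × StandardTriod) ↦ (x.1, x.2.1)))).sub
          (g.continuous.comp (continuous_contract.comp (by fun_prop :
            Continuous fun x : I × (StandardTriod × StandardTriod) ↦ (x.1, x.2.2))))) _⟩
  let c : C(StandardTriod × StandardTriod, ℂ) := .const _ (Complex.log (f (leg 0 0) - g (leg 0 0)))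
  have H_zero : ∀ a, H (0, a) = ⟨Complex.exp (c a), Complex.exp_ne_zero _⟩ := fun a ↦
    Subtype.ext (by
      simp [H, c, contract_zero, Complex.exp_log (sub_ne_zero.2 (hfg (leg 0 0) (leg 0 0)))])
  let Γ := Complex.isCoveringMap_exp.liftHomotopy H c H_zero
  refine ⟨⟨fun a ↦ Γ (1, a), by fun_prop⟩, fun p q ↦ ?_⟩
  have : Complex.exp (Γ (1, p, q)) = f (contract 1 p) - g (contract 1 q) := congrArg Subtype.val
    (congrFun (Complex.isCoveringMap_exp.liftHomotopy_lifts H c H_zero) (1, (p, q)))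
  rwa [contract_one, contract_one] at this

theorem exists_le_norm_sub (f : C(StandardTriod, ℂ)) (hf : Function.Injective f) :
    ∃ ε > 0, ∀ i j, i ≠ j → ∀ t, ε ≤ ‖f (leg i 1) - f (leg j t)‖ := by
  let D : Set ((Fin 3 × Fin 3) × I) := {x | x.1.1 ≠ x.1.2}
  have hD : IsCompact D :=
    (isClosed_discrete {y : Fin 3 × Fin 3 | y.1 ≠ y.2} |>.preimage continuous_fst).isCompact
  have hcont : Continuous fun x : (Fin 3 × Fin 3) × I ↦ ‖f (leg x.1.1 1) - f (leg x.1.2 x.2)‖ :=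
    continuous_prod_of_discrete_left.2 fun y ↦ by
      have := continuous_leg y.2
      change Continuous fun t ↦ ‖f (leg y.1 1) - f (leg y.2 t)‖
      fun_prop
  obtain ⟨⟨⟨i, j⟩, t⟩, hij, hmin⟩ :=
    hD.exists_isMinOn ⟨((0, 1), 0), by simp [D]⟩ hcont.continuousOn
  refine ⟨_, norm_pos_iff.2 (sub_ne_zero.2 (hf.ne (leg_ne_leg hij t))), fun i' j' h t' ↦ ?_⟩
  exact hmin (show ((i', j'), t') ∈ D from h)

/-- A map sufficiently close to an embedding of the standard triod in the plane
has an image meeting that of the embedding. -/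
theorem exists_pos_forall_dist_lt_exists_eq (f : C(StandardTriod, ℂ)) (hf : Function.Injective f) :
    ∃ ε > 0, ∀ g : C(StandardTriod, ℂ), dist g f < ε → ∃ p q, f p = g q := by
  obtain ⟨ε, hε, hsep⟩ := exists_le_norm_sub f hf
  refine ⟨ε, hε, fun g hg ↦ ?_⟩
  by_contra! hfg
  obtain ⟨L, hL⟩ := exists_exp_eq_sub f g hfg
  let R (p q : StandardTriod) : ℂ := (f p - g q) / (f p - f q)
  let M (p q : StandardTriod) : ℂ := L (p, q) - Complex.log (R p q)
  have hR : ∀ p q, ε ≤ ‖f p - f q‖ → R p q ∈ Complex.slitPlane := fun p q h ↦ by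
    have h0 : f p - f q ≠ 0 := norm_pos_iff.1 (hε.trans_le h)
    have : R p q = 1 + (f q - g q) / (f p - f q) := by
      simp only [R]; field_simp; ring
    rw [this]
    refine Complex.mem_slitPlane_of_norm_lt_one ?_
    rw [norm_div, div_lt_one (hε.trans_le h), ← dist_eq_norm, dist_comm]
    exact ((ContinuousMap.dist_apply_le_dist q).trans_lt hg).trans_le h
  have hM : ∀ p q, ε ≤ ‖f p - f q‖ → Complex.exp (M p q) = f p - f q := fun p q h ↦ by
    have h0 : f p - f q ≠ 0 := norm_pos_iff.1 (hε.trans_le h)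
    have h1 : f p - g q ≠ 0 := sub_ne_zero.2 (hfg p q)
    simp only [M]
    rw [Complex.exp_sub, hL, Complex.exp_log (Complex.slitPlane_ne_zero (hR p q h))]
    simp only [R]
    field_simp
  let c (p q : StandardTriod) : ℂ := M q p - M p q
  have hc : ∀ p q, ε ≤ ‖f p - f q‖ → Complex.exp (c p q) = -1 := fun p q h ↦ by
    have h0 : f p - f q ≠ 0 := norm_pos_iff.1 (hε.trans_le h)
    simp only [c]
    rw [Complex.exp_sub, hM p q h, hM q p (by rwa [norm_sub_rev]), ← neg_sub, neg_div, div_self h0]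
  have hcont : ∀ i j, i ≠ j → Continuous fun t ↦ c (leg i 1) (leg j t) := fun i j hij ↦ by
    have hl := continuous_leg j
    have hd : ∀ t, f (leg i 1) - f (leg j t) ≠ 0 :=
      fun t ↦ norm_pos_iff.1 (hε.trans_le (hsep i j hij t))
    have hd' : ∀ t, f (leg j t) - f (leg i 1) ≠ 0 :=
      fun t ↦ sub_ne_zero.2 (sub_ne_zero.1 (hd t)).symm
    have h1 : Continuous fun t ↦ R (leg i 1) (leg j t) :=
      (by fun_prop : Continuous fun t ↦ f (leg i 1) - g (leg j t)).div₀ (by fun_prop) hd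
    have h2 : Continuous fun t ↦ R (leg j t) (leg i 1) :=
      (by fun_prop : Continuous fun t ↦ f (leg j t) - g (leg i 1)).div₀ (by fun_prop) hd'
    exact ((by fun_prop : Continuous fun t ↦ L (leg j t, leg i 1)).sub
        (h2.clog fun t ↦ hR _ _ (by rw [norm_sub_rev]; exact hsep i j hij t))).sub
      ((by fun_prop : Continuous fun t ↦ L (leg i 1, leg j t)).sub
        (h1.clog fun t ↦ hR _ _ (hsep i j hij t)))
  have hconst : ∀ i j, i ≠ j → c (leg i 1) (leg j 1) = c (leg i 1) (leg 0 0) := fun i j hij ↦ by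
    rw [leg_zero 0 j]
    refine Complex.isCoveringMap_exp.const_of_comp (hcont i j hij) (fun a a' ↦ ?_) 1 0
    exact Subtype.ext ((hc _ _ (hsep i j hij a)).trans (hc _ _ (hsep i j hij a')).symm)
  have hneg : ∀ i j, i ≠ j → c (leg i 1) (leg 0 0) = -c (leg j 1) (leg 0 0) := fun i j hij ↦ by
    rw [← hconst i j hij, ← hconst j i hij.symm]
    simp only [c]
    ring
  have h01 := hneg 0 1 (by decide)
  have h12 := hneg 1 2 (by decide)
  have h02 := hneg 0 2 (by decide)
  have hzero : c (leg 0 1) (leg 0 0) = 0 := by linear_combination (h01 - h12 + h02) / 2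
  have := hc (leg 0 1) (leg 0 0) (leg_zero 1 0 ▸ hsep 0 1 (by decide) 0)
  rw [hzero, Complex.exp_zero] at this
  norm_num at this

/-- Embeddings of the standard triod in the plane with pairwise disjoint images
form a countable family. -/
theorem countable_of_pairwise_disjoint_range {ι : Type*} (F : ι → C(StandardTriod, ℂ))
    (hF : ∀ a, Function.Injective (F a)) (hdisj : ∀ a b p q, F a p = F b q → a = b) :
    Countable ι := by
  let _ : TopologicalSpace ι := .induced F inferInstance
  have : SecondCountableTopology ι := TopologicalSpace.secondCountableTopology_induced _ _ F
  have : DiscreteTopology ι := discreteTopology_iff_isOpen_singleton.2 fun a ↦ by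
    obtain ⟨ε, hε, h⟩ := exists_pos_forall_dist_lt_exists_eq (F a) (hF a)
    refine ⟨ball (F a) ε, isOpen_ball, ?_⟩
    ext b
    refine ⟨fun hb ↦ ?_, ?_⟩
    · obtain ⟨p, q, hpq⟩ := h (F b) hb
      exact (hdisj a b p q hpq).symm
    · rintro rfl
      exact mem_ball_self hε
  exact countable_of_Lindelof_of_discrete

/-- Three injective paths which start at a common point and do not meet again
form an embedding of the standard triod. -/
theorem exists_injective_of_paths (γ : Fin 3 → C(I, ℂ)) (x : ℂ) (hx : ∀ i, γ i 0 = x)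
    (hinj : ∀ i, Function.Injective (γ i))
    (hmeet : ∀ i j, i ≠ j → ∀ s t, γ i s = γ j t → γ i s = x) :
    ∃ f : C(StandardTriod, ℂ), Function.Injective f ∧ ∀ p, ∃ i t, f p = γ i t := by
  let f : C(StandardTriod, ℂ) :=
    ⟨fun p ↦ x + ∑ i, (γ i (projIcc 0 1 zero_le_one (p.1 i)) - x), by
      refine continuous_const.add (continuous_finsetSum _ fun i _ ↦ ?_)
      exact ((γ i).continuous.comp (continuous_projIcc.comp
        ((continuous_apply i).comp continuous_subtype_val))).sub continuous_const⟩
  have hf : ∀ i t, f (leg i t) = γ i t := fun i t ↦ by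
    simp only [f, ContinuousMap.coe_mk, leg]
    rw [Finset.sum_eq_single i]
    · simp
    · intro j _ hj
      rw [Pi.single_eq_of_ne hj, projIcc_left, sub_eq_zero]
      exact hx j
    · simp
  refine ⟨f, fun p q hpq ↦ ?_, fun p ↦ ?_⟩
  · obtain ⟨i, s, rfl⟩ := exists_eq_leg p
    obtain ⟨j, t, rfl⟩ := exists_eq_leg q
    rw [hf, hf] at hpq
    by_cases hij : i = j
    · subst hij
      rw [hinj i hpq]
    · have hs : s = 0 := hinj i ((hmeet i j hij s t hpq).trans (hx i).symm)
      have ht : t = 0 := hinj j ((hmeet j i (Ne.symm hij) t s hpq.symm).trans (hx j).symm)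
      rw [hs, ht, leg_zero]
  · obtain ⟨i, t, rfl⟩ := exists_eq_leg p
    exact ⟨i, t, hf i t⟩

end StandardTriod

/-- From each of its points, a Jordan arc contains an injective path. -/
theorem IsJordanArc.exists_injective_path {X : Type*} [TopologicalSpace X] {A : Set X}
    (hA : IsJordanArc A) {x : X} (hx : x ∈ A) :
    ∃ γ : C(I, X), γ 0 = x ∧ Function.Injective γ ∧ ∀ t, γ t ∈ A := by
  obtain ⟨h⟩ := hA
  obtain ⟨a, ha⟩ : ∃ a, h a = ⟨x, hx⟩ := h.surjective _
  obtain ⟨b, hab⟩ := exists_ne a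
  have hmem : ∀ t : I, AffineMap.lineMap (a : ℝ) (b : ℝ) (t : ℝ) ∈ I := fun t ↦
    (convex_Icc (0 : ℝ) 1).lineMap_mem a.2 b.2 t.2
  refine ⟨⟨fun t ↦ h ⟨_, hmem t⟩, ?_⟩, ?_, fun s t hst ↦ ?_, fun t ↦ Subtype.coe_prop _⟩
  · refine continuous_subtype_val.comp (h.continuous.comp (Continuous.subtype_mk ?_ _))
    exact AffineMap.lineMap_continuous.comp continuous_subtype_val
  · simp [ha]
  · have := congrArg Subtype.val (h.injective (Subtype.ext hst))
    exact Subtype.ext (AffineMap.lineMap_injective ℝ (Subtype.coe_ne_coe.2 hab.symm) this)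

/-- Moore's theorem on triods: any family of pairwise disjoint compact
subsets of the plane, each containing a junction point (a triod), is countable. -/
theorem moore_triod_theorem (S : Set (Set (EuclideanSpace ℝ (Fin 2))))
    (hdisj : S.Pairwise Disjoint)
    (hcpt : ∀ K ∈ S, IsCompact K)
    (htriod : ∀ K ∈ S, ∃ x ∈ K, ∃ A₁ A₂ A₃ : Set (EuclideanSpace ℝ (Fin 2)),
      A₁ ⊆ K ∧ A₂ ⊆ K ∧ A₃ ⊆ K ∧
      IsJordanArc A₁ ∧ IsJordanArc A₂ ∧ IsJordanArc A₃ ∧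
      A₁ ∩ A₂ = {x} ∧ A₁ ∩ A₃ = {x} ∧ A₂ ∩ A₃ = {x}) :
    S.Countable := by
  let e : EuclideanSpace ℝ (Fin 2) ≃ₗᵢ[ℝ] ℂ := Complex.orthonormalBasisOneI.repr.symm
  have key : ∀ K : S, ∃ f : C(StandardTriod, ℂ), Function.Injective f ∧
      ∀ p, ∃ y ∈ (K : Set (EuclideanSpace ℝ (Fin 2))), f p = e y := by
    rintro ⟨K, hK⟩
    obtain ⟨x, -, A₁, A₂, A₃, hK₁, hK₂, hK₃, hA₁, hA₂, hA₃, h₁₂, h₁₃, h₂₃⟩ := htriod K hK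
    have hx₁₂ : x ∈ A₁ ∩ A₂ := h₁₂ ▸ mem_singleton x
    have hx₃ : x ∈ A₃ := (h₁₃ ▸ mem_singleton x : x ∈ A₁ ∩ A₃).2
    let A : Fin 3 → Set (EuclideanSpace ℝ (Fin 2)) := ![A₁, A₂, A₃]
    have hA : ∀ i, IsJordanArc (A i) ∧ x ∈ A i ∧ A i ⊆ K := by
      intro i
      fin_cases i
      exacts [⟨hA₁, hx₁₂.1, hK₁⟩, ⟨hA₂, hx₁₂.2, hK₂⟩, ⟨hA₃, hx₃, hK₃⟩]
    have hAA : ∀ i j, i ≠ j → A i ∩ A j = {x} := by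
      intro i j hij
      fin_cases i <;> fin_cases j <;> first | exact absurd rfl hij | skip
      exacts [h₁₂, h₁₃, inter_comm A₁ A₂ ▸ h₁₂, h₂₃, inter_comm A₁ A₃ ▸ h₁₃,
        inter_comm A₂ A₃ ▸ h₂₃]
    choose γ hγ0 hγinj hγA using fun i ↦ (hA i).1.exists_injective_path (hA i).2.1
    obtain ⟨f, hf, hfγ⟩ := StandardTriod.exists_injective_of_paths
      (fun i ↦ (⟨e, e.continuous⟩ : C(_, ℂ)).comp (γ i)) (e x)
      (fun i ↦ congrArg e (hγ0 i)) (fun i ↦ e.injective.comp (hγinj i))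
      (fun i j hij s t hst ↦ by
        have hst' : γ i s = γ j t := e.injective hst
        have : γ i s ∈ A i ∩ A j := ⟨hγA i s, hst' ▸ hγA j t⟩
        rw [hAA i j hij] at this
        exact congrArg e this)
    refine ⟨f, hf, fun p ↦ ?_⟩
    obtain ⟨i, t, hp⟩ := hfγ p
    exact ⟨γ i t, (hA i).2.2 (hγA i t), hp⟩
  choose F hF hFK using key
  refine StandardTriod.countable_of_pairwise_disjoint_range F hF fun K K' p q hpq ↦ ?_
  obtain ⟨y, hy, hpy⟩ := hFK K p
  obtain ⟨z, hz, hqz⟩ := hFK K' q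
  have hyz : y = z := e.injective (hpy.symm.trans (hpq.trans hqz))
  by_contra hne
  exact disjoint_left.1 (hdisj K.2 K'.2 (Subtype.coe_ne_coe.2 hne)) hy (hyz ▸ hz)
end
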